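/- arXiv:1211.2758 — 6 statements merged into one kernel-verified Lean document; each statement's English description precedes it below -/
import Mathlib

section
/- There exists a q-Steiner system S_2[2,3,13]; that is, there exists a set B of 3-dimensional subspaces of the vector space (F_2)^13 over the field with two elements such that every 2-dimensional subspace of (F_2)^13 is contained in exactly one element of B. -/
open Module

namespace SingerSteiner

/-! ### Arithmetic modulo `X ^ 13 + X ^ 12 + X ^ 10 + X ^ 9 + 1`, with coefficients packed in a
natural number -/

/-- Multiplication by the variable. -/
def mulX (n : ℕ) : ℕ := (n * 2) ^^^ (n / 4096 % 2 * 13825)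

/-- Product of `b` with the polynomial given by the lowest `k` bits of `a`. -/
def mulAux : ℕ → ℕ → ℕ → ℕ
  | 0, _, _ => 0
  | k + 1, a, b => (a % 2 * b) ^^^ mulX (mulAux k (a / 2) b)

/-- The power of the variable with exponent `e < 2 ^ k`. -/
def powX : ℕ → ℕ → ℕ
  | 0, _ => 1
  | k + 1, e => mulAux 13 (mulAux 13 (powX k (e / 2)) (powX k (e / 2))) (e % 2 + 1)

section CommRing

variable {R : Type*} [CommRing R]

/-- The value at `α` of the polynomial given by the lowest `k` bits of `n`. -/
def evalBits (α : R) (k n : ℕ) : R := ∑ i ∈ Finset.range k, if n.testBit i then α ^ i else 0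

theorem evalBits_xor (h2 : (2 : R) = 0) (α : R) (k m n : ℕ) :
    evalBits α k (m ^^^ n) = evalBits α k m + evalBits α k n := by
  unfold evalBits
  rw [← Finset.sum_add_distrib]
  refine Finset.sum_congr rfl fun i _ ↦ ?_
  rw [Nat.testBit_xor]
  by_cases hm : m.testBit i <;> by_cases hn : n.testBit i <;> simp [hm, hn, ← two_mul, h2]

theorem evalBits_toNat_mul (α : R) (k n : ℕ) (b : Bool) :
    evalBits α k (b.toNat * n) = if b then evalBits α k n else 0 := by
  cases b <;> simp [evalBits]

theorem evalBits_succ (α : R) (k n : ℕ) :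
    evalBits α (k + 1) n = α * evalBits α k (n / 2) + if n.testBit 0 then 1 else 0 := by
  simp [evalBits, Finset.sum_range_succ', Finset.mul_sum, Nat.testBit_succ, pow_succ',
    -Nat.testBit_zero]

theorem evalBits_mulX (h2 : (2 : R) = 0) {α : R} (hα : α ^ 13 = α ^ 12 + α ^ 10 + α ^ 9 + 1)
    (n : ℕ) : evalBits α 13 (mulX n) = α * evalBits α 13 n := by
  have hP : evalBits α 13 13825 = α ^ 13 := by
    rw [hα]
    simp [evalBits, Finset.sum_range_succ, Nat.testBit_eq_decide_div_mod_eq]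
    ring
  have hb : n / 4096 % 2 = (n.testBit 12).toNat := (Nat.toNat_testBit n 12).symm
  rw [mulX, evalBits_xor h2, hb, evalBits_toNat_mul, hP, evalBits_succ,
    Nat.mul_div_cancel n two_pos]
  have h13 : evalBits α 13 n = evalBits α 12 n + if n.testBit 12 then α ^ 12 else 0 :=
    Finset.sum_range_succ _ _
  rw [h13]
  by_cases hn : n.testBit 12 <;> simp [hn]
  ring

theorem evalBits_mulAux (h2 : (2 : R) = 0) {α : R} (hα : α ^ 13 = α ^ 12 + α ^ 10 + α ^ 9 + 1)
    (k a b : ℕ) : evalBits α 13 (mulAux k a b) = evalBits α k a * evalBits α 13 b := by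
  induction k generalizing a with
  | zero => simp [mulAux, evalBits]
  | succ k ih =>
    have hb : a % 2 = (a.testBit 0).toNat := by simpa using (Nat.toNat_testBit a 0).symm
    rw [mulAux, evalBits_xor h2, hb, evalBits_toNat_mul, evalBits_mulX h2 hα, ih,
      evalBits_succ α k a]
    split_ifs <;> ring

theorem evalBits_powX (h2 : (2 : R) = 0) {α : R} (hα : α ^ 13 = α ^ 12 + α ^ 10 + α ^ 9 + 1)
    (k e : ℕ) (he : e < 2 ^ k) : evalBits α 13 (powX k e) = α ^ e := by
  induction k generalizing e with
  | zero =>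
    obtain rfl : e = 0 := by simpa using he
    simp [powX, evalBits, Finset.sum_range_succ, Nat.testBit_eq_decide_div_mod_eq]
  | succ k ih =>
    have h1 : evalBits α 13 (e % 2 + 1) = α ^ (e % 2) := by
      rcases Nat.mod_two_eq_zero_or_one e with h | h <;>
        simp [h, evalBits, Finset.sum_range_succ, Nat.testBit_eq_decide_div_mod_eq]
    rw [powX, evalBits_mulAux h2 hα, evalBits_mulAux h2 hα, ih _ (by omega), h1, ← pow_add,
      ← pow_add]
    congr 1
    omega

end CommRing

/-! ### The base blocks -/

/-- Exponents of the nonzero elements of the base blocks, with respect to a root of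
`X ^ 13 + X ^ 12 + X ^ 10 + X ^ 9 + 1`. -/
def blocks : List (List ℕ) :=
  [[0, 1, 1249, 5040, 7258, 7978, 8105], [0, 7, 1857, 6681, 7259, 7381, 7908],
   [0, 9, 1144, 1945, 6771, 7714, 8102], [0, 11, 209, 1941, 2926, 3565, 6579],
   [0, 12, 2181, 2519, 3696, 6673, 6965], [0, 13, 4821, 5178, 7823, 8052, 8110],
   [0, 17, 291, 1199, 5132, 6266, 8057], [0, 20, 1075, 3939, 3996, 4776, 7313],
   [0, 21, 2900, 4226, 4915, 6087, 8008], [0, 27, 1190, 3572, 4989, 5199, 6710],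
   [0, 30, 141, 682, 2024, 6256, 6406], [0, 31, 814, 1161, 1243, 4434, 6254],
   [0, 37, 258, 2093, 4703, 5396, 6469], [0, 115, 949, 1272, 1580, 4539, 4873],
   [0, 119, 490, 5941, 6670, 6812, 7312]]

/-- A base block, a power of the Frobenius map, and two distinct elements of the block. -/
def pairs : List (List ℕ × ℕ × ℕ × ℕ) :=
  blocks.flatMap fun B ↦ (List.range 13).flatMap fun s ↦ B.flatMap fun a ↦
    (B.filter (a ≠ ·)).map fun b ↦ (B, s, a, b)

/-- The exponent of the quotient of the two elements. -/
def ratio (t : List ℕ × ℕ × ℕ × ℕ) : ℕ := (t.2.2.1 + (8191 - t.2.2.2)) * 2 ^ t.2.1 % 8191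

/-- The set of members of a list, as a bit mask. -/
def mask (L : List ℕ) : ℕ := L.foldr (fun n m ↦ 2 ^ n ||| m) 0

theorem testBit_mask (L : List ℕ) (n : ℕ) : (mask L).testBit n = true ↔ n ∈ L := by
  induction L with
  | nil => simp [mask]
  | cons a L ih =>
    have : mask (a :: L) = 2 ^ a ||| mask L := rfl
    rw [this, Nat.testBit_or, Nat.testBit_two_pow, Bool.or_eq_true, ih, decide_eq_true_eq,
      List.mem_cons, eq_comm]

theorem mem_pairs {B : List ℕ} {s a b : ℕ} :
    (B, s, a, b) ∈ pairs ↔ B ∈ blocks ∧ s < 13 ∧ a ∈ B ∧ b ∈ B ∧ a ≠ b := by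
  simp only [pairs, List.mem_flatMap, List.mem_map, List.mem_filter, List.mem_range,
    Prod.mk.injEq, decide_eq_true_eq]
  grind

set_option maxRecDepth 100000 in
theorem length_pairs : pairs.length = 8190 := by decide +kernel

set_option maxRecDepth 100000 in
theorem mask_ratio : mask (pairs.map ratio) = 2 ^ (8190 + 1) - 2 := by decide +kernel

theorem powX_8191 : powX 13 8191 = 1 := by decide +kernel

theorem block_add : ∀ B ∈ blocks, ∀ a ∈ B, ∀ b ∈ B, a ≠ b →
    ∃ c ∈ B, powX 13 a ^^^ powX 13 b = powX 13 c := by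
  decide +kernel

theorem block_lt : ∀ B ∈ blocks, ∀ a ∈ B, a < 8191 := by decide +kernel

theorem block_card : ∀ B ∈ blocks, B.toFinset.card = 7 := by decide +kernel

theorem testBit_two_pow_sub_two {k n : ℕ} (h0 : n ≠ 0) (hn : n < k + 1) :
    (2 ^ (k + 1) - 2).testBit n = true := by
  obtain ⟨m, rfl⟩ := Nat.exists_eq_succ_of_ne_zero h0
  have h : 2 ^ (k + 1) - 2 = 2 * (2 ^ k - 1) := by rw [Nat.mul_sub, ← pow_succ']
  rw [h, Nat.testBit_succ, Nat.mul_div_cancel_left _ two_pos, Nat.testBit_two_pow_sub_one]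
  exact decide_eq_true (by omega)

theorem exists_ratio_eq {n : ℕ} (h0 : n ≠ 0) (hn : n < 8191) : ∃ t ∈ pairs, ratio t = n := by
  have h := testBit_two_pow_sub_two (k := 8190) h0 hn
  rw [← mask_ratio, testBit_mask] at h
  exact List.mem_map.1 h

/-! ### The orbits of the base blocks in the field with `2 ^ 13` elements -/

section Field

variable {F : Type*} [Field F] {α : F}

/-- The elements of the image of a base block under a power of the Frobenius map, scaled by `g`. -/
def orbitBlock (α : F) (B : List ℕ) (s : ℕ) (g : F) : Set F :=
  {x | x = 0 ∨ ∃ a ∈ B, x = g * α ^ (a * 2 ^ s)}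

/-- The quotient of the two elements of a member of `pairs`. -/
def quot (α : F) (t : List ℕ × ℕ × ℕ × ℕ) : F :=
  α ^ (t.2.2.1 * 2 ^ t.2.1) / α ^ (t.2.2.2 * 2 ^ t.2.1)

theorem ne_zero_of_root (hα : α ^ 13 = α ^ 12 + α ^ 10 + α ^ 9 + 1) : α ≠ 0 := by
  rintro rfl
  simp at hα

theorem pow_eq_one_of_root {R : Type*} [CommRing R] (h2 : (2 : R) = 0) {α : R}
    (hα : α ^ 13 = α ^ 12 + α ^ 10 + α ^ 9 + 1) : α ^ 8191 = 1 := by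
  have h0 := evalBits_powX h2 hα 13 0 (by norm_num)
  have h1 := evalBits_powX h2 hα 13 8191 (by norm_num)
  have h : powX 13 0 = 1 := by decide +kernel
  rw [h, pow_zero] at h0
  rw [← h1, powX_8191, h0]

theorem orderOf_root (h2 : (2 : F) = 0) (hα : α ^ 13 = α ^ 12 + α ^ 10 + α ^ 9 + 1) :
    orderOf α = 8191 := by
  have : Fact (Nat.Prime 8191) := ⟨by norm_num⟩
  refine orderOf_eq_prime (pow_eq_one_of_root h2 hα) ?_
  rintro rfl
  exact one_ne_zero (α := F) (by linear_combination hα + 2 * h2)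

theorem pow_two_pow_injective (h2 : (2 : F) = 0) (s : ℕ) :
    Function.Injective fun x : F ↦ x ^ 2 ^ s := by
  have := CharTwo.of_one_ne_zero_of_two_eq_zero (one_ne_zero (α := F)) h2
  exact iterateFrobenius_inj F 2 s

theorem mul_pow_inj (h2 : (2 : F) = 0) (hα : α ^ 13 = α ^ 12 + α ^ 10 + α ^ 9 + 1)
    {g : F} (hg : g ≠ 0) {a b s : ℕ} (ha : a < 8191) (hb : b < 8191)
    (h : g * α ^ (a * 2 ^ s) = g * α ^ (b * 2 ^ s)) : a = b := by
  rw [mul_right_inj' hg, pow_mul, pow_mul] at h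
  refine pow_injOn_Iio_orderOf ?_ ?_ (pow_two_pow_injective h2 s h) <;>
    simpa [orderOf_root h2 hα]

theorem exists_quot_eq (h2 : (2 : F) = 0) (hα : α ^ 13 = α ^ 12 + α ^ 10 + α ^ 9 + 1)
    (hF : Nat.card F = 8192) {z : F} (hz0 : z ≠ 0) (hz1 : z ≠ 1) : ∃ t ∈ pairs, quot α t = z := by
  have : Finite F := Nat.finite_of_card_ne_zero (by simp [hF])
  have : Fact (Nat.Prime 8191) := ⟨by norm_num⟩
  have hα0 := ne_zero_of_root hα
  have hord := orderOf_root h2 hα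
  have hcard : Nat.card Fˣ = 8191 := by rw [Nat.card_units, hF]
  have hα1 : Units.mk0 α hα0 ≠ 1 := by
    intro h
    have h1 : α = 1 := by simpa using congrArg Units.val h
    simp [h1] at hord
  obtain ⟨k, hk⟩ := mem_powers_of_prime_card (g' := Units.mk0 z hz0) hcard hα1
  have hk : α ^ k = z := by simpa using congrArg Units.val hk
  have hk' : α ^ (k % 8191) = z := by rw [← hk, ← hord, pow_mod_orderOf]
  have hk0 : k % 8191 ≠ 0 := by
    intro h
    simp [h] at hk'
    exact hz1 hk'.symm
  obtain ⟨⟨B, s, a, b⟩, ht, hr⟩ := exists_ratio_eq hk0 (Nat.mod_lt _ (by norm_num))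
  refine ⟨_, ht, ?_⟩
  obtain ⟨hB, -, -, hb, -⟩ := mem_pairs.1 ht
  have hb := block_lt B hB b hb
  rw [← hk', ← hr, quot, div_eq_iff (pow_ne_zero _ hα0), ratio, ← hord, pow_mod_orderOf, hord,
    ← pow_add, ← add_mul, show a + (8191 - b) + b = a + 8191 by omega, add_mul, pow_add,
    pow_mul α 8191, pow_eq_one_of_root h2 hα, one_pow, mul_one]

theorem quot_injOn (h2 : (2 : F) = 0) (hα : α ^ 13 = α ^ 12 + α ^ 10 + α ^ 9 + 1)
    (hF : Nat.card F = 8192) {t u : List ℕ × ℕ × ℕ × ℕ} (ht : t ∈ pairs) (hu : u ∈ pairs)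
    (h : quot α t = quot α u) : t = u := by
  classical
  have : Finite F := Nat.finite_of_card_ne_zero (by simp [hF])
  have := Fintype.ofFinite F
  have hsub : (Finset.univ \ {0, 1} : Finset F) ⊆ pairs.toFinset.image (quot α) := by
    intro z hz
    simp only [Finset.mem_sdiff, Finset.mem_univ, true_and, Finset.mem_insert,
      Finset.mem_singleton, not_or] at hz
    simpa using exists_quot_eq h2 hα hF hz.1 hz.2
  have hle := Finset.card_le_card hsub
  rw [Finset.card_sdiff_of_subset (Finset.subset_univ _), Finset.card_univ,
    ← Nat.card_eq_fintype_card, hF, Finset.card_pair zero_ne_one] at hle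
  have hlen := List.toFinset_card_le pairs
  rw [length_pairs] at hlen
  have hinj := Finset.card_image_iff.1 (Finset.card_image_le.antisymm (hlen.trans hle))
  exact hinj (by simpa using ht) (by simpa using hu) h

variable [Algebra (ZMod 2) F]

theorem exists_submodule_eq_orbitBlock (h2 : (2 : F) = 0)
    (hα : α ^ 13 = α ^ 12 + α ^ 10 + α ^ 9 + 1) {B : List ℕ} (hB : B ∈ blocks) (s : ℕ) (g : F) :
    ∃ K : Submodule (ZMod 2) F, (K : Set F) = orbitBlock α B s g := by
  have := CharTwo.of_one_ne_zero_of_two_eq_zero (one_ne_zero (α := F)) h2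
  have hadd : ∀ {x y : F}, x ∈ orbitBlock α B s g → y ∈ orbitBlock α B s g →
      x + y ∈ orbitBlock α B s g := by
    rintro x y (rfl | ⟨a, ha, rfl⟩) (rfl | ⟨b, hb, rfl⟩)
    · exact .inl (by simp)
    · exact .inr ⟨b, hb, by simp⟩
    · exact .inr ⟨a, ha, by simp⟩
    · rcases eq_or_ne a b with rfl | hab
      · exact .inl (CharTwo.add_self_eq_zero _)
      obtain ⟨c, hc, h⟩ := block_add B hB a ha b hb hab
      have hpow {e : ℕ} (he : e ∈ B) := evalBits_powX h2 hα 13 e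
        ((block_lt B hB e he).trans (by norm_num))
      refine .inr ⟨c, hc, ?_⟩
      rw [pow_mul, pow_mul, pow_mul, ← mul_add, ← add_pow_char_pow, ← hpow ha, ← hpow hb,
        ← hpow hc, ← evalBits_xor h2, h]
  refine ⟨{ carrier := orbitBlock α B s g, add_mem' := hadd, zero_mem' := .inl rfl,
            smul_mem' := fun c x hx ↦ ?_ }, rfl⟩
  rcases (by decide : ∀ c : ZMod 2, c = 0 ∨ c = 1) c with rfl | rfl
  · exact .inl (zero_smul _ _)
  · rwa [one_smul]

theorem finrank_eq_three_of_eq_orbitBlock (h2 : (2 : F) = 0)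
    (hα : α ^ 13 = α ^ 12 + α ^ 10 + α ^ 9 + 1) {B : List ℕ} (hB : B ∈ blocks) {s : ℕ} {g : F}
    (hg : g ≠ 0) {K : Submodule (ZMod 2) F} (hK : (K : Set F) = orbitBlock α B s g) :
    finrank (ZMod 2) K = 3 := by
  classical
  have hset : (K : Set F) =
      (insert 0 (B.toFinset.image fun a ↦ g * α ^ (a * 2 ^ s)) : Finset F) := by
    rw [hK]
    ext x
    simp [orbitBlock, eq_comm]
  have hcard : Nat.card K = 8 := by
    change Nat.card (K : Set F) = 8
    rw [hset, Nat.card_coe_set_eq, Set.ncard_coe_finset, Finset.card_insert_of_notMem,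
      Finset.card_image_of_injOn, block_card B hB]
    · intro a ha b hb h
      exact mul_pow_inj h2 hα hg (block_lt B hB a (by simpa using ha))
        (block_lt B hB b (by simpa using hb)) h
    · simp [hg, ne_zero_of_root hα]
  have hfin : Finite K := Nat.finite_of_card_ne_zero (by simp [hcard])
  have h := Module.natCard_eq_pow_finrank (K := ZMod 2) (V := K)
  rw [hcard, Nat.card_zmod] at h
  exact Nat.pow_right_injective le_rfl (h.symm.trans (by norm_num))

theorem existsUnique_orbitBlock (h2 : (2 : F) = 0) (hα : α ^ 13 = α ^ 12 + α ^ 10 + α ^ 9 + 1)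
    (hF : Nat.card F = 8192) {x y : F} (hx : x ≠ 0) (hy : y ≠ 0) (hxy : x ≠ y) :
    ∃! K : Submodule (ZMod 2) F,
      (∃ B ∈ blocks, ∃ s < 13, ∃ g ≠ 0, (K : Set F) = orbitBlock α B s g) ∧ x ∈ K ∧ y ∈ K := by
  have hα0 := ne_zero_of_root hα
  obtain ⟨⟨B, s, a, b⟩, ht, hq⟩ := exists_quot_eq h2 hα hF (div_ne_zero hx hy)
    (by rwa [Ne, div_eq_one_iff_eq hy])
  obtain ⟨hB, hs, ha, hb, -⟩ := mem_pairs.1 ht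
  have hb0 : α ^ (b * 2 ^ s) ≠ 0 := pow_ne_zero _ hα0
  obtain ⟨K, hK⟩ := exists_submodule_eq_orbitBlock h2 hα hB s (y / α ^ (b * 2 ^ s))
  refine ⟨K, ⟨⟨B, hB, s, hs, _, div_ne_zero hy hb0, hK⟩, ?_, ?_⟩, ?_⟩
  · rw [← SetLike.mem_coe, hK]
    refine .inr ⟨a, ha, ?_⟩
    simp only [quot] at hq
    field_simp at hq ⊢
    linear_combination -hq
  · rw [← SetLike.mem_coe, hK]
    exact .inr ⟨b, hb, (div_mul_cancel₀ _ hb0).symm⟩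
  · rintro K' ⟨⟨B', hB', s', hs', g, hg, hK'⟩, hxK, hyK⟩
    rw [← SetLike.mem_coe, hK'] at hxK hyK
    obtain ⟨a', ha', hxa⟩ := hxK.resolve_left hx
    obtain ⟨b', hb', hyb⟩ := hyK.resolve_left hy
    have hab : a' ≠ b' := by
      rintro rfl
      exact hxy (hxa.trans hyb.symm)
    have hq' : quot α (B', s', a', b') = x / y := by
      rw [hxa, hyb, mul_div_mul_left _ _ hg, quot]
    have heq := quot_injOn h2 hα hF ht (mem_pairs.2 ⟨hB', hs', ha', hb', hab⟩) (hq.trans hq'.symm)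
    simp only [Prod.mk.injEq] at heq
    obtain ⟨rfl, rfl, rfl, rfl⟩ := heq
    apply SetLike.coe_injective
    rw [hK, hK', hyb, mul_div_cancel_right₀ _ hb0]

end Field

open Polynomial in
theorem exists_root : ∃ α : GaloisField 2 13, α ^ 13 = α ^ 12 + α ^ 10 + α ^ 9 + 1 := by
  have hcard : Nat.card (GaloisField 2 13) = 8191 + 1 := GaloisField.card 2 13 (by norm_num)
  set q := Nat.card (GaloisField 2 13)
  let p : (ZMod 2)[X] := X ^ 13 - (X ^ 12 + X ^ 10 + X ^ 9 + 1)
  have hdeg : p.degree = 13 := by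
    unfold p
    compute_degree!
  have hdvd : p ∣ X ^ q - X := by
    have hr : (AdjoinRoot.root p) ^ 13 =
        AdjoinRoot.root p ^ 12 + AdjoinRoot.root p ^ 10 + AdjoinRoot.root p ^ 9 + 1 := by
      rw [← sub_eq_zero]
      calc
        _ = AdjoinRoot.mk p (X ^ 13 - (X ^ 12 + X ^ 10 + X ^ 9 + 1)) := by
          simp only [map_sub, map_add, map_pow, map_one, AdjoinRoot.mk_X]
        _ = 0 := AdjoinRoot.mk_self
    have h2 : (2 : AdjoinRoot p) = 0 := by
      rw [← map_ofNat (algebraMap (ZMod 2) (AdjoinRoot p)) 2,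
        show (OfNat.ofNat 2 : ZMod 2) = 0 from rfl, map_zero]
    rw [← AdjoinRoot.mk_eq_zero, map_sub, map_pow, AdjoinRoot.mk_X, hcard, pow_succ,
      pow_eq_one_of_root h2 hr, one_mul, sub_self]
  have hne : (X ^ q - X : (ZMod 2)[X]) ≠ 0 :=
    FiniteField.X_pow_card_sub_X_ne_zero _ (by omega)
  have hs : ((X ^ q - X : (ZMod 2)[X]).map (algebraMap _ (GaloisField 2 13))).Splits :=
    FiniteField.splits_X_pow_nat_card_sub_X 2
  obtain ⟨α, h⟩ := (hs.of_dvd (Polynomial.map_ne_zero hne)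
    (Polynomial.map_dvd _ hdvd)).exists_eval_eq_zero (by rw [degree_map, hdeg]; norm_num)
  refine ⟨α, ?_⟩
  rw [← sub_eq_zero]
  simpa [p] using h

theorem exists_le_iff_of_finrank_eq_two {k V : Type*} [Field k] [AddCommGroup V] [Module k V]
    {T : Submodule k V} (hT : finrank k T = 2) :
    ∃ x y : V, x ≠ 0 ∧ y ≠ 0 ∧ x ≠ y ∧ ∀ K : Submodule k V, T ≤ K ↔ x ∈ K ∧ y ∈ K := by
  have : FiniteDimensional k T := .of_finrank_pos (by simp [hT])
  let b := finBasisOfFinrankEq k T hT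
  have hspan : Submodule.span k {(b 0 : V), (b 1 : V)} = T := by
    have h := congrArg (Submodule.map T.subtype) b.span_eq
    rw [Submodule.map_span, Submodule.map_subtype_top, ← Set.range_comp] at h
    refine Eq.trans (congrArg _ ?_) h
    ext v
    simp [eq_comm]
  refine ⟨b 0, b 1, by simpa using b.ne_zero 0, by simpa using b.ne_zero 1, ?_, fun K ↦ ?_⟩
  · exact fun h ↦ absurd (b.injective (Subtype.ext h)) (by decide)
  · conv_lhs => rw [← hspan]
    simp [Submodule.span_le, Set.insert_subset_iff]

/-- The property of being a `q`-Steiner system is invariant under linear isomorphism. -/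
theorem exists_steiner_of_linearEquiv {k V W : Type*} [Field k] [AddCommGroup V] [Module k V]
    [AddCommGroup W] [Module k W] (e : V ≃ₗ[k] W) (m n : ℕ)
    (h : ∃ B : Set (Submodule k V), (∀ K ∈ B, finrank k K = n) ∧
      ∀ T : Submodule k V, finrank k T = m → ∃! K, K ∈ B ∧ T ≤ K) :
    ∃ B : Set (Submodule k W), (∀ K ∈ B, finrank k K = n) ∧
      ∀ T : Submodule k W, finrank k T = m → ∃! K, K ∈ B ∧ T ≤ K := by
  obtain ⟨B, hB, hT⟩ := h
  let f := Submodule.orderIsoMapComap e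
  have hf (K : Submodule k V) : finrank k (f K) = finrank k K := e.finrank_map_eq K
  refine ⟨{K | f.symm K ∈ B}, fun K hK ↦ ?_, fun T h ↦ ?_⟩
  · rw [← hB _ hK, ← hf, f.apply_symm_apply]
  · obtain ⟨K, ⟨hK, hle⟩, huniq⟩ := hT (f.symm T) (by rw [← hf, f.apply_symm_apply, h])
    refine ⟨f K, ⟨by simpa using hK, f.symm_apply_le.1 hle⟩, fun K' ⟨hK', hle'⟩ ↦ ?_⟩
    rw [← huniq (f.symm K') ⟨hK', f.symm.monotone hle'⟩, f.apply_symm_apply]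

end SingerSteiner

open SingerSteiner

/-- There exists a q-Steiner system S_2[2,3,13]: a set of 3-dimensional subspaces of
(F_2)^13 such that every 2-dimensional subspace is contained in exactly one of them. -/
theorem qSteiner_S2_2_3_13_exists :
    ∃ B : Set (Submodule (ZMod 2) (Fin 13 → ZMod 2)),
      (∀ K ∈ B, finrank (ZMod 2) K = 3) ∧
      ∀ T : Submodule (ZMod 2) (Fin 13 → ZMod 2), finrank (ZMod 2) T = 2 →
        ∃! K, K ∈ B ∧ T ≤ K := by
  have hcard : Nat.card (GaloisField 2 13) = 8192 := GaloisField.card 2 13 (by norm_num)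
  have h2 : (2 : GaloisField 2 13) = 0 := CharTwo.two_eq_zero
  obtain ⟨α, hα⟩ := exists_root
  have e : GaloisField 2 13 ≃ₗ[ZMod 2] (Fin 13 → ZMod 2) :=
    LinearEquiv.ofFinrankEq _ _ (by rw [GaloisField.finrank 2 (by norm_num)]; simp)
  refine exists_steiner_of_linearEquiv e 2 3
    ⟨{K | ∃ B ∈ blocks, ∃ s < 13, ∃ g ≠ 0, (K : Set _) = orbitBlock α B s g}, ?_, fun T hT ↦ ?_⟩
  · rintro K ⟨B, hB, s, -, g, hg, hK⟩
    exact finrank_eq_three_of_eq_orbitBlock h2 hα hB hg hK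
  · obtain ⟨x, y, hx, hy, hxy, hT⟩ := exists_le_iff_of_finrank_eq_two hT
    simpa only [hT, Set.mem_ofPred_eq] using existsUnique_orbitBlock h2 hα hcard hx hy hxy
end

section
/- There exists a Steiner system S(3,8,8192); that is, on a set of 8192 points there exists a collection B of 8-element subsets (blocks) such that every 3-element subset of the point set is contained in exactly one block of B. -/
open Finset

/-- Exponent sets of fifteen base blocks: for a root `α` of `X ^ 13 + X ^ 4 + X ^ 3 + X + 1` over
`𝔽₂`, the powers of `α` with exponents in one list are the nonzero vectors of a
three-dimensional subspace. -/
def baseExponents : List (List ℕ) :=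
  [[0, 5401, 7256, 4872, 3586, 7698, 3475],
   [0, 1618, 7032, 2070, 355, 3874, 5869],
   [0, 5271, 3546, 5223, 7984, 6869, 5823],
   [0, 6592, 3639, 32, 5315, 508, 7843],
   [0, 4063, 2979, 6388, 8020, 4981, 3110],
   [0, 6129, 716, 5290, 7455, 38, 2143],
   [0, 5587, 2141, 417, 6229, 6066, 6087],
   [0, 7746, 7349, 6053, 4783, 3245, 5845],
   [0, 8048, 6924, 6081, 6870, 7971, 5988],
   [0, 2291, 5818, 6886, 5142, 2788, 1947],
   [0, 5494, 2504, 4489, 3703, 3412, 3569],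
   [0, 1718, 472, 2058, 625, 3567, 2591],
   [0, 5028, 45, 3793, 2570, 6021, 1695],
   [0, 3906, 2150, 791, 3268, 2980, 1446],
   [0, 649, 7901, 3091, 6834, 2151, 2123]]

/-! ### Differences of exponents -/

/-- The bitwise disjunction of the numbers `f x` for `x` in a list. -/
def listOr {ι : Type*} (l : List ι) (f : ι → ℕ) : ℕ :=
  l.foldr (fun x m => f x ||| m) 0

theorem testBit_listOr {ι : Type*} (l : List ι) (f : ι → ℕ) (d : ℕ) :
    (listOr l f).testBit d = true ↔ ∃ x ∈ l, (f x).testBit d = true := by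
  induction l with
  | nil => simp [listOr]
  | cons x l ih =>
    have h : listOr (x :: l) f = f x ||| listOr l f := rfl
    simp [h, ih]

theorem listOr_differences :
    listOr (List.range 13) (fun k => listOr baseExponents fun l =>
      listOr l fun a => listOr l fun b =>
        2 ^ ((a + (8191 - b)) * 2 ^ k % 8191)) = 2 ^ 8191 - 1 := by
  decide +kernel

theorem exists_difference {d : ℕ} (hd : d < 8191) :
    ∃ k < 13, ∃ l ∈ baseExponents, ∃ a ∈ l, ∃ b ∈ l, (a + (8191 - b)) * 2 ^ k % 8191 = d := by
  have h : (2 ^ 8191 - 1).testBit d = true := by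
    rw [Nat.testBit_two_pow_sub_one, decide_eq_true hd]
  rw [← listOr_differences] at h
  simpa only [testBit_listOr, List.mem_range, Nat.testBit_two_pow, decide_eq_true_eq] using h

/-! ### Arithmetic of binary-coded polynomials -/

/-- The element of `R` coded by the low thirteen binary digits of `n`, as a polynomial in `α`. -/
def evalCode {R : Type*} [CommRing R] (α : R) (n : ℕ) : R :=
  ∑ i ∈ range 13, if n.testBit i then α ^ i else 0

/-- Multiplication of a code by the variable, modulo `X ^ 13 + X ^ 4 + X ^ 3 + X + 1`. -/
def timesX (n : ℕ) : ℕ :=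
  (2 * n) ^^^ (8219 * (n / 4096 % 2))

/-- Horner's scheme for the product of `m` with the number coded by the low `i` digits of `n`,
taken after the remaining digits contributed `acc`. -/
def mulCodeAux (m n : ℕ) : ℕ → ℕ → ℕ
  | 0, acc => acc
  | i + 1, acc => mulCodeAux m n i (timesX acc ^^^ (m * (n / 2 ^ i % 2)))

/-- Multiplication of codes. -/
def mulCode (m n : ℕ) : ℕ := mulCodeAux m n 13 0

/-- The code of `X ^ n`, for `n < 2 ^ k`. -/
def powCode : ℕ → ℕ → ℕ
  | 0, _ => 1
  | k + 1, n =>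
    let s := powCode k (n / 2)
    bif n % 2 == 1 then timesX (mulCode s s) else mulCode s s

theorem powCode_order : powCode 13 8191 = 1 := by decide +kernel

theorem xor_powCode_mem : ∀ l ∈ baseExponents, ∀ x ∈ 0 :: l.map (powCode 13),
    ∀ y ∈ 0 :: l.map (powCode 13), x ^^^ y ∈ 0 :: l.map (powCode 13) := by
  decide +kernel

theorem baseExponents_nodup : ∀ l ∈ baseExponents, l.Nodup ∧ l.length = 7 ∧ ∀ a ∈ l, a < 8191 := by
  decide +kernel

section evalCode

variable {R : Type*} [CommRing R] (α : R)

theorem evalCode_zero : evalCode α 0 = 0 := by simp [evalCode]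

theorem evalCode_one : evalCode α 1 = 1 := by simp [evalCode, sum_range_succ, Nat.testBit]

theorem evalCode_xor [CharP R 2] (m n : ℕ) :
    evalCode α (m ^^^ n) = evalCode α m + evalCode α n := by
  rw [evalCode, evalCode, evalCode, ← sum_add_distrib]
  refine sum_congr rfl fun i _ => ?_
  rw [Nat.testBit_xor]
  cases m.testBit i <;> cases n.testBit i <;> simp [CharTwo.add_self_eq_zero]

theorem evalCode_mul_digit (m n i : ℕ) :
    evalCode α (m * (n / 2 ^ i % 2)) = if n.testBit i then evalCode α m else 0 := by
  rcases Nat.mod_two_eq_zero_or_one (n / 2 ^ i) with h | h <;>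
    simp [Nat.testBit_eq_decide_div_mod_eq, h, evalCode_zero]

variable {α} [CharP R 2] (hα : α ^ 13 = α ^ 4 + α ^ 3 + α + 1)
include hα

theorem evalCode_timesX (n : ℕ) : evalCode α (timesX n) = α * evalCode α n := by
  have h₁ : evalCode α 8219 = α ^ 13 := by
    rw [hα]
    simp [evalCode, sum_range_succ, Nat.testBit]
    ring
  have h₂ : evalCode α (2 * n) + (if n.testBit 12 then α ^ 13 else 0) = α * evalCode α n := by
    have h : ∀ i, (2 * n).testBit (i + 1) = n.testBit i := fun i => by
      rw [Nat.testBit_succ, Nat.mul_div_cancel_left n two_pos]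
    rw [evalCode, evalCode, sum_range_succ', sum_range_succ _ 12, mul_add, mul_sum]
    simp only [h, mul_ite, mul_zero, ← pow_succ']
    simp
  rw [timesX, evalCode_xor, ← h₂]
  have := evalCode_mul_digit α 8219 n 12
  norm_num at this
  rw [this, h₁]

theorem evalCode_mulCodeAux (m n i acc : ℕ) :
    evalCode α (mulCodeAux m n i acc) = α ^ i * evalCode α acc +
      evalCode α m * ∑ j ∈ range i, if n.testBit j then α ^ j else 0 := by
  induction i generalizing acc with
  | zero => simp [mulCodeAux]
  | succ i ih =>
    rw [mulCodeAux, ih, evalCode_xor, evalCode_timesX hα, evalCode_mul_digit, sum_range_succ]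
    split_ifs <;> ring

theorem evalCode_mulCode (m n : ℕ) :
    evalCode α (mulCode m n) = evalCode α m * evalCode α n := by
  rw [mulCode, evalCode_mulCodeAux hα, evalCode_zero, mul_zero, zero_add]
  rfl

theorem evalCode_powCode (k n : ℕ) (hn : n < 2 ^ k) : evalCode α (powCode k n) = α ^ n := by
  induction k generalizing n with
  | zero =>
    obtain rfl : n = 0 := by simpa using hn
    simp [powCode, evalCode_one]
  | succ k ih =>
    have hs := ih (n / 2) (by omega)
    have hn2 := Nat.div_add_mod n 2
    rcases Nat.mod_two_eq_zero_or_one n with h | h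
    · rw [h] at hn2
      conv_rhs => rw [← hn2]
      simp [powCode, h, evalCode_mulCode hα, hs]
      ring
    · rw [h] at hn2
      conv_rhs => rw [← hn2]
      simp [powCode, h, evalCode_timesX hα, evalCode_mulCode hα, hs]
      ring

theorem pow_order_eq_one : α ^ 8191 = 1 := by
  rw [← evalCode_powCode hα 13 8191 (by norm_num), powCode_order, evalCode_one]

theorem orderOf_root [Nontrivial R] : orderOf α = 8191 := by
  have : Fact (Nat.Prime 8191) := ⟨by norm_num⟩
  refine orderOf_eq_prime (pow_order_eq_one hα) ?_
  rintro rfl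
  simp only [one_pow, CharTwo.add_self_eq_zero, zero_add] at hα
  simp at hα

end evalCode

/-! ### The field with `2 ^ 13` elements -/

theorem exists_root_galoisField :
    ∃ α : GaloisField 2 13, α ^ 13 = α ^ 4 + α ^ 3 + α + 1 := by
  classical
  let P : Polynomial (ZMod 2) := .X ^ 13 - (.X ^ 4 + .X ^ 3 + .X + 1)
  have hP : P.degree = 13 := by unfold P; compute_degree!
  have : Nontrivial (AdjoinRoot P) := AdjoinRoot.nontrivial P (by simp [hP])
  have : CharP (AdjoinRoot P) 2 :=
    charP_of_injective_algebraMap (algebraMap (ZMod 2) (AdjoinRoot P)).injective 2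
  have hroot : AdjoinRoot.root P ^ 13 = AdjoinRoot.root P ^ 4 + AdjoinRoot.root P ^ 3 +
      AdjoinRoot.root P + 1 := by
    have h : AdjoinRoot.mk P (.X ^ 13 - (.X ^ 4 + .X ^ 3 + .X + 1)) = 0 := AdjoinRoot.mk_self
    simpa only [map_sub, map_pow, map_add, map_one, AdjoinRoot.mk_X, sub_eq_zero] using h
  let K := GaloisField 2 13
  have : Fintype K := Fintype.ofFinite K
  have hK : Fintype.card K = 8192 := by
    rw [← Nat.card_eq_fintype_card, GaloisField.card 2 13 (by norm_num)]; norm_num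
  have hdvd : P ∣ .X ^ 8192 - .X := by
    rw [← AdjoinRoot.mk_eq_zero, map_sub, map_pow, AdjoinRoot.mk_X, pow_succ,
      pow_order_eq_one hroot, one_mul, sub_self]
  have hsplits := FiniteField.splits_X_pow_card_sub_X (p := 2) (K := K)
  rw [hK] at hsplits
  have hne : (Polynomial.X ^ 8192 - Polynomial.X : Polynomial (ZMod 2)) ≠ 0 :=
    FiniteField.X_pow_card_sub_X_ne_zero _ (by norm_num)
  obtain ⟨α, h⟩ := (hsplits.of_dvd (Polynomial.map_ne_zero hne)
    (Polynomial.map_dvd (algebraMap (ZMod 2) K) hdvd)).exists_eval_eq_zero (by simp [hP])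
  exact ⟨α, by simpa [P, sub_eq_zero] using h⟩

/-! ### Ratios of vectors in the base blocks -/

/-- Pairs of distinct exponents in a base block, together with a power of Frobenius. -/
def ratioIndices : Finset (Σ _ : ℕ × List ℕ, ℕ × ℕ) :=
  (range 13 ×ˢ baseExponents.toFinset).sigma fun p => p.2.toFinset.offDiag

theorem card_ratioIndices_le : ratioIndices.card ≤ 8190 := by
  have hcard : ∀ p ∈ range 13 ×ˢ baseExponents.toFinset, p.2.toFinset.offDiag.card ≤ 42 := by
    rintro ⟨k, l⟩ hp
    obtain ⟨hnodup, hlength, -⟩ := baseExponents_nodup l (by simpa using (mem_product.1 hp).2)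
    simp [offDiag_card, List.toFinset_card_of_nodup hnodup, hlength]
  have h := sum_le_card_nsmul _ _ _ hcard
  have h₁₅ : baseExponents.toFinset.card ≤ 15 := List.toFinset_card_le _
  rw [card_product, card_range, smul_eq_mul] at h
  rw [ratioIndices, card_sigma]
  omega

attribute [irreducible] baseExponents ratioIndices

theorem root_ne_zero {R : Type*} [CommRing R] [Nontrivial R] {α : R}
    (hα : α ^ 13 = α ^ 4 + α ^ 3 + α + 1) : α ≠ 0 := by
  rintro rfl
  simp at hα

section Field

variable {F : Type*} [Field F] [CharP F 2] {α : F}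

/-- The ratio of two vectors in the image of a base block under a power of Frobenius. -/
def blockRatio (α : F) (x : Σ _ : ℕ × List ℕ, ℕ × ℕ) : F :=
  (α ^ x.2.1 / α ^ x.2.2) ^ 2 ^ x.1.1

/-- The additive subgroup spanned by a base block. -/
def baseSubgroup (α : F) (l : List ℕ) (hl : l ∈ baseExponents) : AddSubgroup F where
  carrier := {x | ∃ n ∈ 0 :: l.map (powCode 13), evalCode α n = x}
  zero_mem' := ⟨0, List.mem_cons_self, evalCode_zero α⟩
  add_mem' := by
    rintro _ _ ⟨m, hm, rfl⟩ ⟨n, hn, rfl⟩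
    exact ⟨m ^^^ n, xor_powCode_mem l hl m hm n hn, evalCode_xor α m n⟩
  neg_mem' := by
    rintro x hx
    rwa [CharTwo.neg_eq]

/-- The image of a base block under the map `x ↦ c * x ^ 2 ^ k`. -/
def blockSubgroup (α c : F) (k : ℕ) (l : List ℕ) (hl : l ∈ baseExponents) : AddSubgroup F :=
  (baseSubgroup α l hl).map
    ((AddMonoidHom.mulLeft c).comp (iterateFrobenius F 2 k).toAddMonoidHom)

variable (hα : α ^ 13 = α ^ 4 + α ^ 3 + α + 1)
include hα

theorem root_pow_injOn : Set.InjOn (α ^ · : ℕ → F) (Set.Iio 8191) := by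
  rw [← orderOf_root hα]
  exact pow_injOn_Iio_orderOf

theorem exists_pow_eq (hF : Nat.card F = 8192) {t : F} (ht : t ≠ 0) :
    ∃ d < 8191, α ^ d = t := by
  classical
  have : Finite F := Nat.finite_of_card_ne_zero (by omega)
  have : Fintype F := Fintype.ofFinite F
  have hsub : (range 8191).image (α ^ ·) ⊆ univ.erase 0 := fun x hx => by
    obtain ⟨d, -, rfl⟩ := mem_image.1 hx
    simp [root_ne_zero hα]
  have himage : (range 8191).image (α ^ ·) = univ.erase 0 := by
    refine eq_of_subset_of_card_le hsub ?_
    rw [card_image_of_injOn (by simpa using root_pow_injOn hα), card_erase_of_mem (mem_univ 0),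
      card_univ, ← Nat.card_eq_fintype_card, hF, card_range]
  have := himage ▸ mem_erase.2 ⟨ht, mem_univ t⟩
  simpa using this

theorem exists_blockRatio_eq (hF : Nat.card F = 8192) {t : F} (ht₀ : t ≠ 0) (ht₁ : t ≠ 1) :
    ∃ x ∈ ratioIndices, blockRatio α x = t := by
  obtain ⟨d, hd, rfl⟩ := exists_pow_eq hα hF ht₀
  obtain ⟨k, hk, l, hl, a, ha, b, hb, h⟩ := exists_difference hd
  have hratio : α ^ a / α ^ b = α ^ (a + (8191 - b)) := by
    have hb' : b < 8191 := (baseExponents_nodup l hl).2.2 b hb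
    rw [div_eq_iff (pow_ne_zero _ (root_ne_zero hα)), ← pow_add,
      show a + (8191 - b) + b = a + 8191 by omega, pow_add, pow_order_eq_one hα, mul_one]
  have heq : blockRatio α ⟨(k, l), (a, b)⟩ = α ^ d := by
    rw [blockRatio, hratio, ← pow_mul, ← h, ← pow_mod_orderOf α (_ * _), orderOf_root hα]
  refine ⟨⟨(k, l), (a, b)⟩, ?_, heq⟩
  have hab : a ≠ b := by
    rintro rfl
    rw [blockRatio, div_self (pow_ne_zero _ (root_ne_zero hα)), one_pow] at heq
    exact ht₁ heq.symm
  simp [ratioIndices, hk, hl, ha, hb, hab]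

theorem blockRatio_injOn (hF : Nat.card F = 8192) :
    Set.InjOn (blockRatio α) ratioIndices := by
  classical
  have : Finite F := Nat.finite_of_card_ne_zero (by omega)
  have : Fintype F := Fintype.ofFinite F
  have hsub : (univ.erase 0).erase 1 ⊆ ratioIndices.image (blockRatio α) := fun t ht => by
    rw [mem_erase, mem_erase] at ht
    exact mem_image.2 (exists_blockRatio_eq hα hF ht.2.1 ht.1)
  have hcard : ((univ.erase 0).erase (1 : F)).card = 8190 := by
    rw [card_erase_of_mem (by simp), card_erase_of_mem (mem_univ 0), card_univ,
      ← Nat.card_eq_fintype_card, hF]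
  refine card_image_iff.1 (le_antisymm card_image_le ?_)
  exact card_ratioIndices_le.trans (hcard.ge.trans (card_le_card hsub))

/-! ### The blocks -/

theorem mem_baseSubgroup {l : List ℕ} (hl : l ∈ baseExponents) {x : F} :
    x ∈ baseSubgroup α l hl ↔ x = 0 ∨ ∃ a ∈ l, α ^ a = x := by
  have h : ∀ a ∈ l, evalCode α (powCode 13 a) = α ^ a := fun a ha =>
    evalCode_powCode hα 13 a (((baseExponents_nodup l hl).2.2 a ha).trans (by norm_num))
  change (∃ n ∈ 0 :: l.map (powCode 13), evalCode α n = x) ↔ _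
  simp only [List.mem_cons, List.mem_map, exists_eq_or_imp, evalCode_zero, exists_exists_and_eq_and,
    eq_comm (a := (0 : F))]
  exact or_congr_right (exists_congr fun a => and_congr_right fun ha => by rw [h a ha])

theorem card_baseSubgroup {l : List ℕ} (hl : l ∈ baseExponents) :
    Nat.card (baseSubgroup α l hl) = 8 := by
  classical
  obtain ⟨hnodup, hlength, hlt⟩ := baseExponents_nodup l hl
  have h : (baseSubgroup α l hl : Set F) = insert 0 (l.toFinset.image (α ^ ·)) := by
    ext x
    simp [mem_baseSubgroup hα hl]
  have hcard : (l.toFinset.image (α ^ ·)).card = 7 := by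
    rw [card_image_of_injOn, List.toFinset_card_of_nodup hnodup, hlength]
    exact (root_pow_injOn hα).mono fun a ha => hlt a (by simpa using ha)
  have h₀ : (0 : F) ∉ l.toFinset.image (α ^ ·) := by simp [root_ne_zero hα]
  rw [← SetLike.coe_sort_coe, Nat.card_coe_set_eq, h, Set.ncard_coe_finset,
    card_insert_of_notMem h₀, hcard]

theorem mem_blockSubgroup {c : F} {k : ℕ} {l : List ℕ} (hl : l ∈ baseExponents) {x : F} :
    x ∈ blockSubgroup α c k l hl ↔ x = 0 ∨ ∃ a ∈ l, c * (α ^ a) ^ 2 ^ k = x := by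
  simp [blockSubgroup, mem_baseSubgroup hα hl, iterateFrobenius_def, or_and_right, exists_or,
    eq_comm (a := (0 : F))]

theorem card_blockSubgroup {c : F} (hc : c ≠ 0) (k : ℕ) {l : List ℕ} (hl : l ∈ baseExponents) :
    Nat.card (blockSubgroup α c k l hl) = 8 := by
  rw [← card_baseSubgroup hα hl, blockSubgroup]
  refine Nat.card_congr (AddSubgroup.equivMapOfInjective _ _ ?_).symm.toEquiv
  exact (mul_right_injective₀ hc).comp (iterateFrobenius F 2 k).injective

theorem exists_mem_blockSubgroup (hF : Nat.card F = 8192) {u v : F} (hu : u ≠ 0) (hv : v ≠ 0)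
    (huv : u ≠ v) : ∃ c : F, c ≠ 0 ∧ ∃ k < 13, ∃ l, ∃ hl : l ∈ baseExponents,
      u ∈ blockSubgroup α c k l hl ∧ v ∈ blockSubgroup α c k l hl := by
  obtain ⟨⟨⟨k, l⟩, a, b⟩, hx, h⟩ := exists_blockRatio_eq hα hF (div_ne_zero hu hv)
    (fun h => huv ((div_eq_one_iff_eq hv).1 h))
  simp only [ratioIndices, mem_sigma, mem_product, mem_range, List.mem_toFinset,
    mem_offDiag] at hx
  have hpow : ∀ n, (α ^ n) ^ 2 ^ k ≠ 0 := fun n =>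
    pow_ne_zero _ (pow_ne_zero _ (root_ne_zero hα))
  refine ⟨v / (α ^ b) ^ 2 ^ k, div_ne_zero hv (hpow b), k, hx.1.1, l, hx.1.2,
    (mem_blockSubgroup hα _).2 (.inr ⟨a, hx.2.1, ?_⟩),
    (mem_blockSubgroup hα _).2 (.inr ⟨b, hx.2.2.1, div_mul_cancel₀ _ (hpow b)⟩)⟩
  have := hpow b
  simp only [blockRatio, div_pow] at h
  rw [div_eq_div_iff this hv] at h
  rw [div_mul_eq_mul_div, div_eq_iff this, ← h, mul_comm]

theorem blockSubgroup_unique (hF : Nat.card F = 8192) {u v : F} (hu : u ≠ 0) (hv : v ≠ 0)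
    (huv : u ≠ v) {c c' : F} (hc : c ≠ 0) (hc' : c' ≠ 0) {k k' : ℕ} (hk : k < 13) (hk' : k' < 13)
    {l l' : List ℕ} (hl : l ∈ baseExponents) (hl' : l' ∈ baseExponents)
    (hul : u ∈ blockSubgroup α c k l hl) (hvl : v ∈ blockSubgroup α c k l hl)
    (hul' : u ∈ blockSubgroup α c' k' l' hl') (hvl' : v ∈ blockSubgroup α c' k' l' hl') :
    blockSubgroup α c k l hl = blockSubgroup α c' k' l' hl' := by
  simp only [mem_blockSubgroup hα, hu, hv, false_or] at hul hvl hul' hvl'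
  obtain ⟨a, ha, hau⟩ := hul
  obtain ⟨b, hb, hbv⟩ := hvl
  obtain ⟨a', ha', hau'⟩ := hul'
  obtain ⟨b', hb', hbv'⟩ := hvl'
  have hab : a ≠ b := by
    rintro rfl
    exact huv (hau.symm.trans hbv)
  have hab' : a' ≠ b' := by
    rintro rfl
    exact huv (hau'.symm.trans hbv')
  have hx : (⟨(k, l), (a, b)⟩ : Σ _ : ℕ × List ℕ, ℕ × ℕ) ∈ ratioIndices := by
    simp [ratioIndices, hk, hl, ha, hb, hab]
  have hx' : (⟨(k', l'), (a', b')⟩ : Σ _ : ℕ × List ℕ, ℕ × ℕ) ∈ ratioIndices := by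
    simp [ratioIndices, hk', hl', ha', hb', hab']
  have h := blockRatio_injOn hα hF hx hx' <| by
    simp only [blockRatio, div_pow]
    rw [← mul_div_mul_left _ _ hc, hau, hbv, ← hau', ← hbv', mul_div_mul_left _ _ hc']
  obtain ⟨⟨rfl, rfl⟩, rfl, rfl⟩ : (k = k' ∧ l = l') ∧ a = a' ∧ b = b' := by simpa using h
  obtain rfl : c = c' := mul_right_cancel₀
    (pow_ne_zero _ (pow_ne_zero _ (root_ne_zero hα))) (hau.trans hau'.symm)
  rfl

end Field

/-- If every pair of distinct nonzero elements of a finite abelian group lies in exactly one member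
of a family of subgroups of order `q`, then the cosets of these subgroups are the blocks of a
Steiner system with `t = 3`. -/
theorem exists_steiner_three_of_addSubgroups {V : Type*} [AddCommGroup V] [Finite V] {q : ℕ}
    (S : Set (AddSubgroup V)) (hcard : ∀ W ∈ S, Nat.card W = q)
    (hS : ∀ u v : V, u ≠ 0 → v ≠ 0 → u ≠ v → ∃! W, W ∈ S ∧ u ∈ W ∧ v ∈ W) :
    ∃ B : Set (Finset V), (∀ b ∈ B, b.card = q) ∧
      ∀ s : Finset V, s.card = 3 → ∃! b, b ∈ B ∧ s ⊆ b := by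
  classical
  have : Fintype V := Fintype.ofFinite V
  let coset (x : V) (W : AddSubgroup V) : Finset V := univ.filter (· - x ∈ W)
  have hcoset : ∀ {x y : V} {W : AddSubgroup V}, y ∈ coset x W → coset x W = coset y W := by
    intro x y W hy
    ext z
    have hy : y - x ∈ W := by simpa [coset] using hy
    have h : z - x ∈ W ↔ z - y ∈ W := by
      rw [← sub_add_sub_cancel z y x, add_mem_cancel_right hy]
    simpa [coset] using h
  refine ⟨{b | ∃ x, ∃ W ∈ S, coset x W = b}, ?_, fun s hs => ?_⟩
  · rintro _ ⟨x, W, hW, rfl⟩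
    rw [← hcard W hW, ← Nat.subtype_card (p := (· - x ∈ W)) (coset x W) (by simp [coset])]
    exact Nat.card_congr ((Equiv.subRight x).subtypeEquiv fun y => Iff.rfl)
  · obtain ⟨x, y, z, hxy, hxz, hyz, rfl⟩ := card_eq_three.1 hs
    obtain ⟨W, ⟨hW, hyW, hzW⟩, huniq⟩ := hS (y - x) (z - x) (sub_ne_zero.2 hxy.symm)
      (sub_ne_zero.2 hxz.symm) (fun h => hyz (sub_left_injective h))
    refine ⟨coset x W, ⟨⟨x, W, hW, rfl⟩, ?_⟩, ?_⟩
    · simp [insert_subset_iff, coset, hyW, hzW]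
    · rintro _ ⟨⟨w, W', hW', rfl⟩, hsub⟩
      have hw := hcoset (hsub (mem_insert_self x _))
      rw [hw] at hsub ⊢
      rw [huniq W' ⟨hW', ?_, ?_⟩]
      · simpa [coset] using hsub (show y ∈ ({x, y, z} : Finset V) by simp)
      · simpa [coset] using hsub (show z ∈ ({x, y, z} : Finset V) by simp)

/-- Steiner systems can be transported along a bijection of the point sets. -/
theorem exists_steiner_of_equiv {V V' : Type*} (e : V ≃ V') {t q : ℕ}
    (h : ∃ B : Set (Finset V), (∀ b ∈ B, b.card = q) ∧
      ∀ s : Finset V, s.card = t → ∃! b, b ∈ B ∧ s ⊆ b) :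
    ∃ B : Set (Finset V'), (∀ b ∈ B, b.card = q) ∧
      ∀ s : Finset V', s.card = t → ∃! b, b ∈ B ∧ s ⊆ b := by
  obtain ⟨B, hB, hs⟩ := h
  refine ⟨{b | e.symm.finsetCongr b ∈ B}, fun b hb => ?_, fun s hst => ?_⟩
  · simpa using hB _ hb
  · obtain ⟨b, ⟨hbB, hsb⟩, huniq⟩ := hs (e.symm.finsetCongr s) (by simpa using hst)
    refine ⟨e.finsetCongr b, ⟨?_, ?_⟩, fun b' hb' => ?_⟩
    · simpa [Finset.map_map] using hbB
    · simpa [Finset.map_map] using map_subset_map (f := e.toEmbedding).2 hsb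
    · rw [← huniq (e.symm.finsetCongr b') ⟨hb'.1, map_subset_map.2 hb'.2⟩]
      simp [Finset.map_map]

/-- There exists a Steiner system S(3,8,8192): a collection of 8-element subsets of an
8192-element point set such that every 3-element subset lies in exactly one block. -/
theorem steiner_3_8_8192_exists :
    ∃ B : Set (Finset (Fin 8192)),
      (∀ b ∈ B, b.card = 8) ∧
      ∀ s : Finset (Fin 8192), s.card = 3 → ∃! b, b ∈ B ∧ s ⊆ b := by
  obtain ⟨α, hα⟩ := exists_root_galoisField
  have hF : Nat.card (GaloisField 2 13) = 8192 := by
    rw [GaloisField.card 2 13 (by norm_num)]; norm_num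
  refine exists_steiner_of_equiv (Finite.equivFinOfCardEq hF)
    (exists_steiner_three_of_addSubgroups {W | ∃ c : GaloisField 2 13, c ≠ 0 ∧ ∃ k < 13, ∃ l,
      ∃ hl : l ∈ baseExponents, blockSubgroup α c k l hl = W} ?_ fun u v hu hv huv => ?_)
  · rintro _ ⟨c, hc, k, -, l, hl, rfl⟩
    exact card_blockSubgroup hα hc k hl
  · obtain ⟨c, hc, k, hk, l, hl, hul, hvl⟩ := exists_mem_blockSubgroup hα hF hu hv huv
    refine ⟨blockSubgroup α c k l hl, ⟨⟨c, hc, k, hk, l, hl, rfl⟩, hul, hvl⟩, ?_⟩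
    rintro _ ⟨⟨c', hc', k', hk', l', hl', rfl⟩, hul', hvl'⟩
    exact blockSubgroup_unique hα hF hu hv huv hc' hc hk' hk hl' hl hul' hvl' hul hvl
end

section
/- If there exists a q-Steiner system S_2[2,k,n], then there exists a Steiner system S(3,2^k,2^n). Precisely: if B is a set of k-dimensional subspaces of (F_2)^n such that every 2-dimensional subspace is contained in exactly one element of B, then the collection of all cosets v + K (for v in (F_2)^n and K in B), viewed as subsets of the 2^n-element set (F_2)^n, is a collection of 2^k-element subsets such that every 3-element subset of (F_2)^n is contained in exactly one of these cosets. -/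
open Module

theorem Submodule.mem_add_left_image {R V : Type*} [Ring R] [AddCommGroup V] [Module R V]
    (K : Submodule R V) (v x : V) :
    x ∈ (fun y => v + y) '' (K : Set V) ↔ x - v ∈ K := by
  constructor
  · rintro ⟨y, hy, rfl⟩
    simpa using hy
  · intro h
    exact ⟨x - v, h, by simp⟩

theorem Submodule.add_left_image_eq_of_sub_mem {R V : Type*} [Ring R] [AddCommGroup V]
    [Module R V] (K : Submodule R V) {v a : V} (h : a - v ∈ K) :
    (fun y => v + y) '' (K : Set V) = (fun y => a + y) '' (K : Set V) := by
  ext x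
  rw [K.mem_add_left_image, K.mem_add_left_image, ← sub_add_sub_cancel x a v,
    K.add_mem_iff_left h]

theorem Submodule.triple_subset_add_left_image_iff {R V : Type*} [Ring R] [AddCommGroup V]
    [Module R V] (K : Submodule R V) (a b c : V) :
    ({a, b, c} : Set V) ⊆ (fun y => a + y) '' (K : Set V) ↔
      Submodule.span R {b - a, c - a} ≤ K := by
  rw [Submodule.span_le]
  simp only [Set.insert_subset_iff, Set.singleton_subset_iff, K.mem_add_left_image, sub_self,
    K.zero_mem, true_and, SetLike.mem_coe]

/-- Over the field with two elements, two distinct nonzero vectors span a plane. -/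
theorem finrank_span_pair_zmod_two {V : Type*} [AddCommGroup V] [Module (ZMod 2) V]
    {x y : V} (hx : x ≠ 0) (hy : y ≠ 0) (hxy : x ≠ y) :
    finrank (ZMod 2) (Submodule.span (ZMod 2) {x, y}) = 2 := by
  have hli : LinearIndependent (ZMod 2) ![x, y] := by
    rw [LinearIndependent.pair_iff' hx]
    intro r
    have hr : r = 0 ∨ r = 1 := by
      revert r
      decide
    rcases hr with rfl | rfl
    · simpa using hy.symm
    · simpa using hxy
  rw [← Matrix.range_cons_cons_empty x y ![], finrank_span_eq_card hli, Fintype.card_fin]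

/-- If `B` is a q-Steiner system S_2[2,k,n], then the collection of cosets `v + K`
for `K ∈ B` forms a Steiner system S(3, 2^k, 2^n) on the point set (F_2)^n:
each coset has 2^k elements, and every 3-element subset of (F_2)^n is contained in
exactly one coset. -/
theorem qSteiner_to_steiner (k n : ℕ)
    (B : Set (Submodule (ZMod 2) (Fin n → ZMod 2)))
    (hdim : ∀ K ∈ B, finrank (ZMod 2) K = k)
    (hSteiner : ∀ T : Submodule (ZMod 2) (Fin n → ZMod 2), finrank (ZMod 2) T = 2 →
      ∃! K, K ∈ B ∧ T ≤ K) :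
    (∀ c ∈ {c : Set (Fin n → ZMod 2) |
        ∃ v : Fin n → ZMod 2, ∃ K ∈ B, c = (fun x => v + x) '' (K : Set (Fin n → ZMod 2))},
      c.ncard = 2 ^ k) ∧
    (∀ s : Set (Fin n → ZMod 2), s.ncard = 3 →
      ∃! c, c ∈ {c : Set (Fin n → ZMod 2) |
          ∃ v : Fin n → ZMod 2, ∃ K ∈ B, c = (fun x => v + x) '' (K : Set (Fin n → ZMod 2))} ∧
        s ⊆ c) := by
  refine ⟨?_, ?_⟩
  · rintro _ ⟨v, K, hK, rfl⟩
    rw [Set.ncard_image_of_injective _ (add_right_injective v), ← hdim K hK,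
      ← Nat.card_coe_set_eq]
    simpa using Module.natCard_eq_pow_finrank (K := ZMod 2) (V := K)
  · intro s hs
    obtain ⟨a, b, c, hab, hac, hbc, rfl⟩ := Set.ncard_eq_three.mp hs
    obtain ⟨K, ⟨hKB, hTK⟩, huniq⟩ := hSteiner (Submodule.span (ZMod 2) {b - a, c - a})
      (finrank_span_pair_zmod_two (sub_ne_zero.mpr hab.symm) (sub_ne_zero.mpr hac.symm)
        (fun h => hbc (sub_left_injective h)))
    refine ⟨(fun x => a + x) '' (K : Set (Fin n → ZMod 2)),
      ⟨⟨a, K, hKB, rfl⟩, (K.triple_subset_add_left_image_iff a b c).mpr hTK⟩, ?_⟩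
    rintro _ ⟨⟨v, L, hLB, rfl⟩, hsub⟩
    have hav : a - v ∈ L := (L.mem_add_left_image v a).mp (hsub (Set.mem_insert _ _))
    rw [L.add_left_image_eq_of_sub_mem hav] at hsub ⊢
    rw [huniq L ⟨hLB, (L.triple_subset_add_left_image_iff a b c).mp hsub⟩]
end

section
/- The maximum number A_2(13,4,3) of codewords of a constant-dimension subspace code in (F_2)^13 with dimension 3 and minimum subspace distance 4 equals 1597245. That is: (a) there exists a set C of 3-dimensional subspaces of (F_2)^13 with |C| = 1597245 such that any two distinct elements U, V of C satisfy dim(U) + dim(V) - 2·dim(U ∩ V) ≥ 4; and (b) every set C of 3-dimensional subspaces of (F_2)^13 in which any two distinct elements satisfy this distance condition has |C| ≤ 1597245. -/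
open Module

/-- Over the field with two elements, a subspace has dimension at most one exactly when it has
at most one nonzero vector. -/
theorem finrank_le_one_iff_zmod_two {V : Type*} [AddCommGroup V] [Module (ZMod 2) V] [Finite V]
    (W : Submodule (ZMod 2) V) :
    finrank (ZMod 2) W ≤ 1 ↔ ∀ x ∈ W, ∀ y ∈ W, x ≠ 0 → y ≠ 0 → x = y := by
  have key : ∀ (v w : W) (c : ZMod 2), w ≠ 0 → c • v = w → v = w := by
    intro v w c hw h
    obtain rfl | rfl : c = 0 ∨ c = 1 := by clear h; revert c; decide
    · exact absurd (by simpa using h.symm) hw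
    · simpa using h
  constructor
  · intro h x hx y hy hx0 hy0
    obtain ⟨v, hv⟩ := finrank_le_one_iff.1 h
    have aux : ∀ z (hz : z ∈ W), z ≠ 0 → (v : V) = z := by
      intro z hz hz0
      obtain ⟨c, hc⟩ := hv ⟨z, hz⟩
      exact congrArg Subtype.val (key v ⟨z, hz⟩ c (by simpa using hz0) hc)
    rw [← aux x hx hx0, aux y hy hy0]
  · intro h
    by_cases hW : ∃ v : W, v ≠ 0
    · obtain ⟨v, hv⟩ := hW
      refine finrank_le_one v fun w => ?_
      by_cases hw : w = 0
      · exact ⟨0, by simp [hw]⟩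
      · refine ⟨1, ?_⟩
        rw [one_smul]
        exact Subtype.ext (h v v.2 w w.2 (by simpa using hv) (by simpa using hw))
    · push Not at hW
      exact finrank_le_one 0 fun w => ⟨0, by simp [hW w]⟩

/-- The ordered pairs of distinct nonzero vectors of a subspace. -/
noncomputable def nonzeroPairs {V : Type*} [AddCommGroup V] [Module (ZMod 2) V] [Fintype V]
    (W : Submodule (ZMod 2) V) : Finset (V × V) := by
  classical exact ((Finset.univ.filter (· ∈ W)).erase 0).offDiag

theorem mem_nonzeroPairs {V : Type*} [AddCommGroup V] [Module (ZMod 2) V] [Fintype V]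
    {W : Submodule (ZMod 2) V} {p : V × V} :
    p ∈ nonzeroPairs W ↔ (p.1 ≠ 0 ∧ p.1 ∈ W) ∧ (p.2 ≠ 0 ∧ p.2 ∈ W) ∧ p.1 ≠ p.2 := by
  simp [nonzeroPairs]

theorem card_nonzeroPairs {V : Type*} [AddCommGroup V] [Module (ZMod 2) V] [Fintype V]
    (W : Submodule (ZMod 2) V) :
    (nonzeroPairs W).card =
      (2 ^ finrank (ZMod 2) W - 1) * (2 ^ finrank (ZMod 2) W - 1) -
        (2 ^ finrank (ZMod 2) W - 1) := by
  classical
  have h : (Finset.univ.filter (· ∈ W)).card = 2 ^ finrank (ZMod 2) W := by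
    have := Module.natCard_eq_pow_finrank (K := ZMod 2) (V := W)
    rw [Nat.card_zmod] at this
    rw [← this, Nat.card_eq_fintype_card, Fintype.card_subtype]
  rw [nonzeroPairs, Finset.offDiag_card, Finset.card_erase_of_mem (by simp)]
  rw [h]

/-- Distinct planes of a code with pairwise intersections of dimension at most one have disjoint
sets of pairs, which bounds the size of the code. -/
theorem card_mul_le_of_finrank_inf_le_one {V : Type*} [AddCommGroup V] [Module (ZMod 2) V]
    [Fintype V] (C : Finset (Submodule (ZMod 2) V)) (h3 : ∀ U ∈ C, finrank (ZMod 2) U = 3)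
    (hC : ∀ U ∈ C, ∀ W ∈ C, U ≠ W → finrank (ZMod 2) ↥(U ⊓ W) ≤ 1) :
    C.card * 42 ≤ (nonzeroPairs (⊤ : Submodule (ZMod 2) V)).card := by
  classical
  have hcard : (C.biUnion nonzeroPairs).card = C.card * 42 := by
    rw [Finset.card_biUnion]
    · rw [Finset.sum_congr rfl (g := fun _ => 42), Finset.sum_const, smul_eq_mul]
      intro U hU
      simp [card_nonzeroPairs, h3 U hU]
    · intro U hU W hW hne
      refine Finset.disjoint_left.2 fun p hpU hpW => ?_
      rw [mem_nonzeroPairs] at hpU hpW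
      exact hpU.2.2 ((finrank_le_one_iff_zmod_two _).1 (hC U hU W hW hne) _
        ⟨hpU.1.2, hpW.1.2⟩ _ ⟨hpU.2.1.2, hpW.2.1.2⟩ hpU.1.1 hpU.2.1.1)
  rw [← hcard]
  refine Finset.card_le_card fun p hp => ?_
  obtain ⟨U, -, hU⟩ := Finset.mem_biUnion.1 hp
  rw [mem_nonzeroPairs] at hU ⊢
  exact ⟨⟨hU.1.1, trivial⟩, ⟨hU.2.1.1, trivial⟩, hU.2.2⟩

namespace BinPoly

/-- The value at `a` of the polynomial over the field with two elements whose coefficients are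
the binary digits of `n`. -/
def eval {R : Type*} [CommRing R] (a : R) (n : ℕ) : R :=
  ∑ i ∈ Finset.range n, if n.testBit i then a ^ i else 0

variable {R : Type*} [CommRing R] (a : R)

theorem eval_eq_sum_range {n N : ℕ} (h : n < 2 ^ N) :
    eval a n = ∑ i ∈ Finset.range N, if n.testBit i then a ^ i else 0 := by
  have aux : ∀ {M M' : ℕ}, n < 2 ^ M → M ≤ M' →
      (∑ i ∈ Finset.range M, if n.testBit i then a ^ i else 0) =
        ∑ i ∈ Finset.range M', if n.testBit i then a ^ i else 0 := by
    intro M M' hM hMM'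
    refine Finset.sum_subset (Finset.range_mono hMM') fun i _ hi => ?_
    rw [Finset.mem_range, not_lt] at hi
    rw [Nat.testBit_lt_two_pow (hM.trans_le (Nat.pow_le_pow_right two_pos hi))]
    simp
  rcases le_total n N with hN | hN
  · exact aux Nat.lt_two_pow_self hN
  · exact (aux h hN).symm

theorem eval_xor [CharP R 2] (m n : ℕ) : eval a (m ^^^ n) = eval a m + eval a n := by
  have hm : m < 2 ^ (m + n) :=
    Nat.lt_two_pow_self.trans_le (Nat.pow_le_pow_right two_pos (Nat.le_add_right m n))
  have hn : n < 2 ^ (m + n) :=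
    Nat.lt_two_pow_self.trans_le (Nat.pow_le_pow_right two_pos (Nat.le_add_left n m))
  rw [eval_eq_sum_range a hm, eval_eq_sum_range a hn,
    eval_eq_sum_range a (Nat.xor_lt_two_pow hm hn), ← Finset.sum_add_distrib]
  refine Finset.sum_congr rfl fun i _ => ?_
  rw [Nat.testBit_xor]
  cases m.testBit i <;> cases n.testBit i <;> simp [CharTwo.add_self_eq_zero]

theorem eval_two_mul (n : ℕ) : eval a (2 * n) = a * eval a n := by
  have hn : n < 2 ^ n := Nat.lt_two_pow_self
  rw [eval_eq_sum_range a (show 2 * n < 2 ^ (n + 1) by rw [pow_succ]; lia),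
    eval_eq_sum_range a hn, Finset.sum_range_succ', Finset.mul_sum]
  simp [Nat.testBit_succ, pow_succ']

theorem eval_one : eval a 1 = 1 := by simp [eval]

theorem eval_zero : eval a 0 = 0 := by simp [eval]

theorem eval_eq_half [CharP R 2] (n : ℕ) :
    eval a n = (bif n.testBit 0 then 1 else 0) + a * eval a (n / 2) := by
  have h : n = (bif n.testBit 0 then 1 else 0) ^^^ (2 * (n / 2)) := by
    refine Nat.eq_of_testBit_eq fun i => ?_
    cases i with
    | zero => cases hb : n.testBit 0 <;> simp
    | succ i =>
      rw [Nat.testBit_xor, Nat.testBit_succ (2 * (n / 2))]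
      cases hb : n.testBit 0 <;> simp [Nat.testBit_succ]
  conv_lhs => rw [h]
  rw [eval_xor, eval_two_mul]
  cases n.testBit 0 <;> simp [eval_zero, eval_one]

/-- Multiplication by the variable modulo `X ^ 13 + X ^ 12 + X ^ 10 + X ^ 9 + 1`. -/
def mulX (n : ℕ) : ℕ := bif n.testBit 12 then (2 * n) ^^^ 13825 else 2 * n

theorem mulX_lt {n : ℕ} (h : n < 2 ^ 13) : mulX n < 2 ^ 13 := by
  refine Nat.lt_pow_two_of_testBit _ fun i hi => ?_
  obtain ⟨i, rfl⟩ : ∃ j, i = j + 13 := ⟨i - 13, by lia⟩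
  cases i with
  | zero =>
    have : (13825).testBit 13 = true := by decide
    have h2 : (2 * n).testBit (0 + 13) = n.testBit 12 := by
      rw [Nat.testBit_succ, Nat.mul_div_cancel_left n two_pos]
    cases hb : n.testBit 12
    · rw [mulX, hb, cond, h2, hb]
    · rw [mulX, hb, cond, Nat.testBit_xor, h2, hb, this, Bool.xor_self]
  | succ i =>
    have h1 : (13825).testBit (i + 1 + 13) = false :=
      Nat.testBit_lt_two_pow (lt_of_lt_of_le (by norm_num : 13825 < 2 ^ 14)
        (Nat.pow_le_pow_right two_pos (by lia)))
    have h2 : (2 * n).testBit (i + 1 + 13) = false :=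
      Nat.testBit_lt_two_pow (lt_of_lt_of_le (by lia : 2 * n < 2 ^ 14)
        (Nat.pow_le_pow_right two_pos (by lia)))
    cases hb : n.testBit 12 <;> simp only [mulX, hb, cond, Nat.testBit_xor, h1, h2, Bool.xor_self]

variable {a} [CharP R 2]

theorem eval_mulX (ha : eval a 13825 = 0) (n : ℕ) : eval a (mulX n) = a * eval a n := by
  cases hb : n.testBit 12 <;> simp [mulX, hb, eval_xor, eval_two_mul, ha]

/-- Multiplication modulo `X ^ 13 + X ^ 12 + X ^ 10 + X ^ 9 + 1`, using the lowest `k` digits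
of the second factor. -/
def mul (m : ℕ) : ℕ → ℕ → ℕ
  | 0, _ => 0
  | k + 1, n => (bif n.testBit 0 then m else 0) ^^^ mulX (mul m k (n / 2))

theorem mul_lt {m : ℕ} (hm : m < 2 ^ 13) (k n : ℕ) : mul m k n < 2 ^ 13 := by
  induction k generalizing n with
  | zero => simp [mul]
  | succ k ih =>
    refine Nat.xor_lt_two_pow ?_ (mulX_lt (ih _))
    cases n.testBit 0
    · simp
    · exact hm

theorem eval_mul (ha : eval a 13825 = 0) (m : ℕ) {k n : ℕ} (hn : n < 2 ^ k) :
    eval a (mul m k n) = eval a m * eval a n := by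
  induction k generalizing n with
  | zero =>
    obtain rfl : n = 0 := by lia
    simp [mul, eval_zero]
  | succ k ih =>
    rw [mul, eval_xor, eval_mulX ha, ih (by lia), eval_eq_half a n]
    cases n.testBit 0 <;> simp [eval_zero] <;> ring

/-- Powers of the variable modulo `X ^ 13 + X ^ 12 + X ^ 10 + X ^ 9 + 1`, for exponents with
at most `k` digits. -/
def powX : ℕ → ℕ → ℕ
  | 0, _ => 1
  | k + 1, e =>
    bif e.testBit 0 then mulX (mul (powX k (e / 2)) 13 (powX k (e / 2)))
    else mul (powX k (e / 2)) 13 (powX k (e / 2))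

theorem powX_lt (k e : ℕ) : powX k e < 2 ^ 13 := by
  induction k generalizing e with
  | zero => simp [powX]
  | succ k ih =>
    rw [powX]
    cases e.testBit 0
    · exact mul_lt (ih _) _ _
    · exact mulX_lt (mul_lt (ih _) _ _)

theorem eval_powX (ha : eval a 13825 = 0) {k e : ℕ} (he : e < 2 ^ k) :
    eval a (powX k e) = a ^ e := by
  induction k generalizing e with
  | zero =>
    obtain rfl : e = 0 := by lia
    simp [powX, eval_one]
  | succ k ih =>
    have hsq : eval a (mul (powX k (e / 2)) 13 (powX k (e / 2))) = a ^ (2 * (e / 2)) := by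
      rw [eval_mul ha _ (powX_lt _ _), ih (by lia), ← pow_add, two_mul]
    rw [powX]
    rcases Nat.mod_two_eq_zero_or_one e with h | h
    · rw [Nat.testBit_zero, h]
      simp only [Nat.zero_ne_one, decide_false, cond, hsq]
      rw [show 2 * (e / 2) = e by lia]
    · rw [Nat.testBit_zero, h]
      simp only [decide_true, cond, eval_mulX ha, hsq]
      rw [← pow_succ', show 2 * (e / 2) + 1 = e by lia]

end BinPoly

/-- A list of naturals all of whose members are found to be distinct by recording them as
binary digits of `mask`. -/
def allFresh : ℕ → List ℕ → Bool
  | _, [] => true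
  | mask, x :: l => bif mask.testBit x then false else allFresh (mask ||| 2 ^ x) l

theorem nodup_of_allFresh {mask : ℕ} {l : List ℕ} (h : allFresh mask l = true) :
    l.Nodup ∧ ∀ x ∈ l, mask.testBit x = false := by
  induction l generalizing mask with
  | nil => simp
  | cons x l ih =>
    rw [allFresh] at h
    cases hx : mask.testBit x
    · rw [hx] at h
      obtain ⟨h1, h2⟩ := ih h
      simp only [Nat.testBit_or, Nat.testBit_two_pow, Bool.or_eq_false_iff,
        decide_eq_false_iff_not] at h2
      refine ⟨List.nodup_cons.2 ⟨fun hmem => (h2 x hmem).2 rfl, h1⟩, ?_⟩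
      rintro y (_ | ⟨_, hy⟩)
      · exact hx
      · exact (h2 y hy).1
    · simp [hx] at h

/-- Discrete logarithms of the nonzero vectors of fifteen planes in the field with `2 ^ 13`
elements: the orbits of these planes under the normalizer of a Singer cycle form the code. -/
def baseBlocks : List (List ℕ) :=
  [[0, 1, 1249, 5040, 7258, 7978, 8105],
   [0, 7, 1857, 6681, 7259, 7381, 7908],
   [0, 9, 1144, 1945, 6771, 7714, 8102],
   [0, 11, 209, 1941, 2926, 3565, 6579],
   [0, 12, 2181, 2519, 3696, 6673, 6965],
   [0, 13, 4821, 5178, 7823, 8052, 8110],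
   [0, 17, 291, 1199, 5132, 6266, 8057],
   [0, 20, 1075, 3939, 3996, 4776, 7313],
   [0, 21, 2900, 4226, 4915, 6087, 8008],
   [0, 27, 1190, 3572, 4989, 5199, 6710],
   [0, 30, 141, 682, 2024, 6256, 6406],
   [0, 31, 814, 1161, 1243, 4434, 6254],
   [0, 37, 258, 2093, 4703, 5396, 6469],
   [0, 115, 949, 1272, 1580, 4539, 4873],
   [0, 119, 490, 5941, 6670, 6812, 7312]]

theorem baseBlocks_lt : ∀ b ∈ baseBlocks, ∀ e ∈ b, e < 8191 := by decide +kernel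

theorem baseBlocks_nodup : ∀ b ∈ baseBlocks, b.Nodup := by decide +kernel

theorem baseBlocks_length : ∀ b ∈ baseBlocks, b.length = 7 := by decide +kernel

theorem nodup_baseBlocks : baseBlocks.Nodup := by decide +kernel

/-- The index set `(b, e, f, i)` of the ordered pairs of distinct nonzero vectors of the base
blocks and their Frobenius conjugates. -/
def pairIndices : List (List ℕ × ℕ × ℕ × ℕ) :=
  baseBlocks.flatMap fun b => b.flatMap fun e => (b.filter (· != e)).flatMap fun f =>
    (List.range 13).map fun i => (b, e, f, i)

/-- The discrete logarithm of the quotient of an ordered pair of vectors. -/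
def quotientLog (p : List ℕ × ℕ × ℕ × ℕ) : ℕ :=
  2 ^ p.2.2.2 * (p.2.2.1 + 8191 - p.2.1) % 8191

theorem nodup_quotientLog : (pairIndices.map quotientLog).Nodup :=
  (nodup_of_allFresh (mask := 0) (by decide +kernel)).1

theorem baseBlocks_xor : ∀ b ∈ baseBlocks, ∀ x ∈ b.map (BinPoly.powX 13),
    ∀ y ∈ b.map (BinPoly.powX 13), x ≠ y → x ^^^ y ∈ b.map (BinPoly.powX 13) := by
  decide +kernel

theorem powX_order : BinPoly.powX 13 8191 = 1 := by decide +kernel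

theorem mem_pairIndices {b : List ℕ} {e f i : ℕ} (hb : b ∈ baseBlocks) (he : e ∈ b) (hf : f ∈ b)
    (hef : e ≠ f) (hi : i < 13) : (b, e, f, i) ∈ pairIndices := by
  simp only [pairIndices, List.mem_flatMap, List.mem_filter, List.mem_map, List.mem_range]
  exact ⟨b, hb, e, he, f, ⟨hf, by simpa using hef.symm⟩, i, hi, rfl⟩

/-- The index set of the code: a base block, a power of the Frobenius map, and a shift. -/
def codeIndices : Finset (List ℕ × ℕ × ℕ) :=
  baseBlocks.toFinset ×ˢ Finset.range 13 ×ˢ Finset.range 8191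

theorem mem_codeIndices {t : List ℕ × ℕ × ℕ} :
    t ∈ codeIndices ↔ t.1 ∈ baseBlocks ∧ t.2.1 < 13 ∧ t.2.2 < 8191 := by
  simp [codeIndices]

theorem card_codeIndices : codeIndices.card = 1597245 := by
  rw [codeIndices, Finset.card_product, Finset.card_product, Finset.card_range,
    Finset.card_range, List.toFinset_card_of_nodup nodup_baseBlocks]
  rfl

theorem eq_of_cast_eq_of_lt {m n : ℕ} (hm : m < 8191) (hn : n < 8191)
    (h : (m : ZMod 8191) = n) : m = n := by
  rwa [ZMod.natCast_eq_natCast_iff', Nat.mod_eq_of_lt hm, Nat.mod_eq_of_lt hn] at h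

theorem isUnit_two_pow_zmod (i : ℕ) : IsUnit ((2 : ZMod 8191) ^ i) :=
  IsUnit.pow i (IsUnit.of_mul_eq_one (b := 4096) (by decide +kernel))

section Plane

variable {R : Type*} [CommRing R] {a : R}

theorem pow_eq_pow_iff_cast (ho : orderOf a = 8191) {m n : ℕ} :
    a ^ m = a ^ n ↔ (m : ZMod 8191) = n := by
  have hfin : IsOfFinOrder a := orderOf_pos_iff.1 (by rw [ho]; norm_num)
  rw [hfin.pow_eq_pow_iff_modEq, ho, ZMod.natCast_eq_natCast_iff]

theorem pow_ne_zero_of_orderOf [Nontrivial R] (ho : orderOf a = 8191) (n : ℕ) : a ^ n ≠ 0 := by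
  have hu : IsUnit a := IsUnit.of_pow_eq_one (n := 8191) (by rw [← ho, pow_orderOf_eq_one])
    (by norm_num)
  exact (hu.pow n).ne_zero

theorem pow_block_injective (ho : orderOf a = 8191) {b : List ℕ} (hb : b ∈ baseBlocks)
    {i g e f : ℕ}
    (he : e ∈ b) (hf : f ∈ b) (h : a ^ (g + 2 ^ i * e) = a ^ (g + 2 ^ i * f)) : e = f := by
  rw [pow_eq_pow_iff_cast ho] at h
  push_cast at h
  exact eq_of_cast_eq_of_lt (baseBlocks_lt b hb e he) (baseBlocks_lt b hb f hf)
    ((isUnit_two_pow_zmod i).mul_left_cancel (add_left_cancel h))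

variable [CharP R 2]

theorem exists_pow_add_pow (ha : BinPoly.eval a 13825 = 0) (ho : orderOf a = 8191) {b : List ℕ}
    (hb : b ∈ baseBlocks) {e f : ℕ} (he : e ∈ b) (hf : f ∈ b) (hef : e ≠ f) :
    ∃ h ∈ b, a ^ e + a ^ f = a ^ h := by
  have hval : ∀ c ∈ b, BinPoly.eval a (BinPoly.powX 13 c) = a ^ c := fun c hc =>
    BinPoly.eval_powX ha ((baseBlocks_lt b hb c hc).trans (by norm_num))
  have hne : BinPoly.powX 13 e ≠ BinPoly.powX 13 f := by
    intro h
    refine hef (pow_block_injective ho hb (i := 0) (g := 0) he hf ?_)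
    simpa [hval e he, hval f hf] using congrArg (BinPoly.eval a) h
  obtain ⟨h, hh, heq⟩ := List.mem_map.1 (baseBlocks_xor b hb _ (List.mem_map_of_mem he) _
    (List.mem_map_of_mem hf) hne)
  refine ⟨h, hh, ?_⟩
  rw [← hval e he, ← hval f hf, ← hval h hh, ← BinPoly.eval_xor, heq]

variable [Algebra (ZMod 2) R]

/-- The plane spanned by the powers of `a` whose exponents come from the base block `t.1` after
applying the Frobenius map `t.2.1` times and shifting by `t.2.2`. -/
def blockPlane (a : R) (t : List ℕ × ℕ × ℕ) : Submodule (ZMod 2) R :=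
  Submodule.span (ZMod 2) {x | ∃ e ∈ t.1, x = a ^ (t.2.2 + 2 ^ t.2.1 * e)}

theorem mem_blockPlane (ha : BinPoly.eval a 13825 = 0) (ho : orderOf a = 8191)
    {t : List ℕ × ℕ × ℕ} (ht : t ∈ codeIndices) {x : R} :
    x ∈ blockPlane a t ↔ x = 0 ∨ ∃ e ∈ t.1, x = a ^ (t.2.2 + 2 ^ t.2.1 * e) := by
  have hb := (mem_codeIndices.1 ht).1
  constructor
  · intro hx
    induction hx using Submodule.span_induction with
    | mem x hx => exact Or.inr hx
    | zero => exact Or.inl rfl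
    | add x y _ _ hx hy =>
      obtain rfl | ⟨e, he, rfl⟩ := hx
      · simpa using hy
      obtain rfl | ⟨f, hf, rfl⟩ := hy
      · exact Or.inr ⟨e, he, add_zero _⟩
      by_cases hef : e = f
      · subst hef
        exact Or.inl (CharTwo.add_self_eq_zero _)
      · obtain ⟨h, hh, hsum⟩ := exists_pow_add_pow ha ho hb he hf hef
        refine Or.inr ⟨h, hh, ?_⟩
        have hfrob : ∀ c : ℕ, a ^ (t.2.2 + 2 ^ t.2.1 * c) = a ^ t.2.2 * (a ^ c) ^ 2 ^ t.2.1 := by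
          intro c
          rw [pow_add, mul_comm (2 ^ t.2.1), pow_mul a c]
        rw [hfrob, hfrob, hfrob, ← mul_add, ← add_pow_char_pow, hsum]
    | smul c x _ hx =>
      obtain rfl | rfl : c = 0 ∨ c = 1 := by revert c; decide
      · exact Or.inl (zero_smul _ _)
      · simpa using hx
  · rintro (rfl | hx)
    · exact zero_mem _
    · exact Submodule.subset_span hx

/-- Two planes of the code with two common nonzero vectors have the same index. -/
theorem index_eq_of_mem_blockPlane (ha : BinPoly.eval a 13825 = 0) (ho : orderOf a = 8191)
    {t t' : List ℕ × ℕ × ℕ} (ht : t ∈ codeIndices) (ht' : t' ∈ codeIndices) {x y : R}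
    (hx : x ∈ blockPlane a t) (hx' : x ∈ blockPlane a t') (hy : y ∈ blockPlane a t)
    (hy' : y ∈ blockPlane a t') (hx0 : x ≠ 0) (hy0 : y ≠ 0) (hxy : x ≠ y) : t = t' := by
  rw [mem_blockPlane ha ho ht] at hx hy
  rw [mem_blockPlane ha ho ht'] at hx' hy'
  obtain ⟨e, he, hxe⟩ := hx.resolve_left hx0
  obtain ⟨e', he', hxe'⟩ := hx'.resolve_left hx0
  obtain ⟨f, hf, hyf⟩ := hy.resolve_left hy0
  obtain ⟨f', hf', hyf'⟩ := hy'.resolve_left hy0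
  obtain ⟨b, i, g⟩ := t
  obtain ⟨b', i', g'⟩ := t'
  obtain ⟨hb, hi, hg⟩ := mem_codeIndices.1 ht
  obtain ⟨hb', hi', hg'⟩ := mem_codeIndices.1 ht'
  dsimp only at *
  have hef : e ≠ f := by
    rintro rfl
    exact hxy (hxe.trans hyf.symm)
  have hef' : e' ≠ f' := by
    rintro rfl
    exact hxy (hxe'.trans hyf'.symm)
  have h1 := (pow_eq_pow_iff_cast ho).1 (hxe.symm.trans hxe')
  have h2 := (pow_eq_pow_iff_cast ho).1 (hyf.symm.trans hyf')
  push_cast at h1 h2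
  have hquot : quotientLog (b, e, f, i) = quotientLog (b', e', f', i') := by
    have h8191 : (8191 : ZMod 8191) = 0 := CharP.cast_eq_zero (ZMod 8191) 8191
    have hle : e ≤ f + 8191 := (baseBlocks_lt b hb e he).le.trans (Nat.le_add_left _ _)
    have hle' : e' ≤ f' + 8191 := (baseBlocks_lt b' hb' e' he').le.trans (Nat.le_add_left _ _)
    refine (ZMod.natCast_eq_natCast_iff' _ _ 8191).1 ?_
    push_cast [Nat.cast_sub hle, Nat.cast_sub hle']
    rw [h8191]
    linear_combination h2 - h1
  have heq := List.inj_on_of_nodup_map nodup_quotientLog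
    (mem_pairIndices hb he hf hef hi) (mem_pairIndices hb' he' hf' hef' hi') hquot
  simp only [Prod.mk.injEq] at heq
  obtain ⟨rfl, rfl, rfl, rfl⟩ := heq
  rw [eq_of_cast_eq_of_lt hg hg' (add_right_cancel h1)]

theorem finrank_blockPlane_inf [Finite R] (ha : BinPoly.eval a 13825 = 0) (ho : orderOf a = 8191)
    {t t' : List ℕ × ℕ × ℕ} (ht : t ∈ codeIndices) (ht' : t' ∈ codeIndices) (hne : t ≠ t') :
    finrank (ZMod 2) ↥(blockPlane a t ⊓ blockPlane a t') ≤ 1 := by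
  rw [finrank_le_one_iff_zmod_two]
  intro x hx y hy hx0 hy0
  by_contra hxy
  exact hne (index_eq_of_mem_blockPlane ha ho ht ht' hx.1 hx.2 hy.1 hy.2 hx0 hy0 hxy)

variable [Nontrivial R]

theorem finrank_blockPlane (ha : BinPoly.eval a 13825 = 0) (ho : orderOf a = 8191)
    {t : List ℕ × ℕ × ℕ} (ht : t ∈ codeIndices) : finrank (ZMod 2) (blockPlane a t) = 3 := by
  classical
  have hb := (mem_codeIndices.1 ht).1
  have hset : (blockPlane a t : Set R) =
      ↑(insert 0 (t.1.toFinset.image fun e => a ^ (t.2.2 + 2 ^ t.2.1 * e))) := by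
    ext x
    simp only [SetLike.mem_coe, mem_blockPlane ha ho ht, Finset.coe_insert, Finset.coe_image,
      Set.mem_insert_iff, Set.mem_image, List.mem_toFinset, eq_comm (a := x)]
  have hcard : Nat.card (blockPlane a t) = 8 := by
    change (blockPlane a t : Set R).ncard = 8
    rw [hset, Set.ncard_coe_finset, Finset.card_insert_of_notMem, Finset.card_image_of_injOn,
      List.toFinset_card_of_nodup (baseBlocks_nodup _ hb), baseBlocks_length _ hb]
    · intro e he f hf h
      exact pow_block_injective ho hb (by simpa using he) (by simpa using hf) h
    · simp [pow_ne_zero_of_orderOf ho]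
  have : Finite (blockPlane a t) := Nat.finite_of_card_ne_zero (by rw [hcard]; norm_num)
  rw [Module.natCard_eq_pow_finrank (K := ZMod 2), Nat.card_zmod] at hcard
  exact Nat.pow_right_injective le_rfl (hcard.trans (by norm_num : 8 = 2 ^ 3))

theorem blockPlane_injOn [Finite R] (ha : BinPoly.eval a 13825 = 0) (ho : orderOf a = 8191) :
    Set.InjOn (blockPlane a) (codeIndices : Set (List ℕ × ℕ × ℕ)) := by
  intro t ht t' ht' h
  by_contra hne
  have h1 := finrank_blockPlane_inf ha ho ht ht' hne
  rw [← h, inf_idem, finrank_blockPlane ha ho ht] at h1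
  norm_num at h1

end Plane

open Polynomial in
/-- A commutative algebra of dimension 13 over the field with two elements that contains an
element of order `2 ^ 13 - 1` with prescribed minimal polynomial. -/
theorem exists_algebra_orderOf_eq : ∃ (R : Type) (_ : CommRing R) (_ : Algebra (ZMod 2) R)
    (_ : CharP R 2) (_ : Nontrivial R) (_ : Module.Finite (ZMod 2) R) (a : R),
    finrank (ZMod 2) R = 13 ∧ BinPoly.eval a 13825 = 0 ∧ orderOf a = 8191 := by
  let p : (ZMod 2)[X] := X ^ 13 + X ^ 12 + X ^ 10 + X ^ 9 + 1
  have hdeg : p.natDegree = 13 := by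
    simp only [p]; compute_degree!
  have hmonic : p.Monic := by
    simp only [p]; monicity!
  have hdim : finrank (ZMod 2) (AdjoinRoot p) = 13 := by
    rw [(AdjoinRoot.powerBasis' hmonic).finrank, AdjoinRoot.powerBasis'_dim, hdeg]
  have : Nontrivial (AdjoinRoot p) := nontrivial_of_finrank_pos (R := ZMod 2) (by lia)
  have : Module.Finite (ZMod 2) (AdjoinRoot p) := (AdjoinRoot.powerBasis' hmonic).finite
  have : CharP (AdjoinRoot p) 2 :=
    charP_of_injective_algebraMap (algebraMap (ZMod 2) (AdjoinRoot p)).injective 2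
  have heval : BinPoly.eval (AdjoinRoot.root p) 13825 = 0 := by
    have hroot : AdjoinRoot.mk p p = 0 := AdjoinRoot.mk_self
    simp only [p, map_add, map_pow, map_one, AdjoinRoot.mk_X] at hroot
    rw [BinPoly.eval_eq_sum_range _ (N := 14) (by norm_num)]
    simp only [Finset.sum_range_succ, Finset.sum_range_zero]
    have hbits : ∀ i < 14, (13825).testBit i = decide (i ∈ [0, 9, 10, 12, 13]) := by decide
    simp only [hbits, Nat.reduceLT, List.mem_cons, List.not_mem_nil]
    norm_num
    linear_combination hroot
  refine ⟨AdjoinRoot p, inferInstance, inferInstance, this, inferInstance, inferInstance,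
    AdjoinRoot.root p, hdim, heval, ?_⟩
  have : Fact (Nat.Prime 8191) := ⟨by norm_num⟩
  refine orderOf_eq_prime ?_ ?_
  · rw [← BinPoly.eval_powX heval (k := 13) (by norm_num), powX_order, BinPoly.eval_one]
  · intro h
    have hdvd : AdjoinRoot.mk p (X - 1) = 0 := by simp [h]
    rw [AdjoinRoot.mk_eq_zero] at hdvd
    have hle := natDegree_le_of_dvd hdvd (X_sub_C_ne_zero (1 : ZMod 2))
    rw [hdeg, ← C_1, natDegree_X_sub_C] at hle
    norm_num at hle

/-- A_2(13,4,3) = 1597245: there is a constant-dimension-3 subspace code in (F_2)^13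
of size 1597245 with minimum subspace distance 4, and no larger such code exists. -/
theorem A2_13_4_3_eq :
    (∃ C : Set (Submodule (ZMod 2) (Fin 13 → ZMod 2)),
      C.ncard = 1597245 ∧
      (∀ U ∈ C, finrank (ZMod 2) U = 3) ∧
      (∀ U ∈ C, ∀ V ∈ C, U ≠ V →
        finrank (ZMod 2) U + finrank (ZMod 2) V - 2 * finrank (ZMod 2) ↥(U ⊓ V) ≥ 4)) ∧
    (∀ C : Set (Submodule (ZMod 2) (Fin 13 → ZMod 2)),
      (∀ U ∈ C, finrank (ZMod 2) U = 3) →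
      (∀ U ∈ C, ∀ V ∈ C, U ≠ V →
        finrank (ZMod 2) U + finrank (ZMod 2) V - 2 * finrank (ZMod 2) ↥(U ⊓ V) ≥ 4) →
      C.ncard ≤ 1597245) := by
  refine ⟨?_, fun C h3 hC => ?_⟩
  · obtain ⟨R, _, _, _, _, _, a, hdim, ha, ho⟩ := exists_algebra_orderOf_eq
    have : Finite R := Module.finite_of_finite (ZMod 2)
    let φ : R ≃ₗ[ZMod 2] (Fin 13 → ZMod 2) := LinearEquiv.ofFinrankEq _ _ (by simp [hdim])
    have hinj : Set.InjOn (fun t => (blockPlane a t).map (φ : R →ₗ[ZMod 2] (Fin 13 → ZMod 2)))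
        codeIndices := fun t ht t' ht' h =>
      blockPlane_injOn ha ho ht ht' (Submodule.map_injective_of_injective φ.injective h)
    have hrank : ∀ t ∈ codeIndices, finrank (ZMod 2)
        ((blockPlane a t).map (φ : R →ₗ[ZMod 2] (Fin 13 → ZMod 2))) = 3 := fun t ht =>
      (LinearEquiv.finrank_map_eq φ _).trans (finrank_blockPlane ha ho ht)
    refine ⟨(fun t => (blockPlane a t).map (φ : R →ₗ[ZMod 2] (Fin 13 → ZMod 2))) '' codeIndices,
      ?_, ?_, ?_⟩
    · rw [hinj.ncard_image, Set.ncard_coe_finset, card_codeIndices]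
    · rintro _ ⟨t, ht, rfl⟩
      exact hrank t ht
    · rintro _ ⟨t, ht, rfl⟩ _ ⟨t', ht', rfl⟩ hne
      have hinf := finrank_blockPlane_inf ha ho ht ht' fun h => hne (by rw [h])
      rw [← LinearEquiv.finrank_map_eq φ] at hinf
      dsimp only
      rw [hrank t ht, hrank t' ht', ← Submodule.map_inf _ φ.injective]
      have hfour : ∀ n ≤ 1, 3 + 3 - 2 * n ≥ 4 := by lia
      exact hfour _ hinf
  · have hfin := C.toFinite
    have hmem : ∀ {U}, U ∈ hfin.toFinset → U ∈ C := fun h => by simpa using h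
    have hbound := card_mul_le_of_finrank_inf_le_one hfin.toFinset (fun U hU => h3 U (hmem hU))
      fun U hU W hW hne => by
        have := hC U (hmem hU) W (hmem hW) hne
        rw [h3 U (hmem hU), h3 W (hmem hW)] at this
        lia
    rw [card_nonzeroPairs, finrank_top, finrank_fin_fun,
      ← Set.ncard_eq_toFinset_card C hfin] at hbound
    lia
end

section
/- Packing bound for A_2(13,4,3): every set C of 3-dimensional subspaces of (F_2)^13 such that any two distinct elements U, V of C satisfy dim(U ∩ V) ≤ 1 has cardinality at most 1597245. -/
open Module

/-- Packing bound by double counting: if the `k`-dimensional subspaces in `C` pairwise intersect in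
dimension less than `t`, then every linearly independent `t`-tuple of vectors lies in at most one
of them. -/
theorem ncard_mul_prod_le_of_finrank_inf_lt {K V : Type*} [Field K] [Fintype K]
    [AddCommGroup V] [Module K V] [Finite V] {k t : ℕ} (C : Set (Submodule K V))
    (htk : t ≤ k) (hkn : t ≤ finrank K V) (hdim : ∀ U ∈ C, finrank K U = k)
    (hinter : ∀ U ∈ C, ∀ W ∈ C, U ≠ W → finrank K ↥(U ⊓ W) < t) :
    C.ncard * ∏ i : Fin t, (Fintype.card K ^ k - Fintype.card K ^ (i : ℕ)) ≤
      ∏ i : Fin t, (Fintype.card K ^ finrank K V - Fintype.card K ^ (i : ℕ)) := by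
  classical
  have : Fintype V := Fintype.ofFinite V
  have : Finite (Submodule K V) := Finite.of_injective _ SetLike.coe_injective
  have : Fintype C := Fintype.ofFinite C
  let f : (Σ U : C, {s : Fin t → U.1 // LinearIndependent K s}) →
      {s : Fin t → V // LinearIndependent K s} := fun p =>
    ⟨fun i => (p.2.1 i : V), p.2.2.map' p.1.1.subtype (Submodule.ker_subtype _)⟩
  have hf : Function.Injective f := by
    rintro ⟨⟨U, hU⟩, s, hs⟩ ⟨⟨W, hW⟩, r, hr⟩ h
    have hval : ∀ i, (s i : V) = r i := fun i => congrFun (congrArg Subtype.val h) i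
    obtain rfl : U = W := by
      by_contra hne
      let g : Fin t → ↥(U ⊓ W) := fun i => ⟨s i, (s i).2, hval i ▸ (r i).2⟩
      have hg : LinearIndependent K g :=
        LinearIndependent.of_comp (U ⊓ W).subtype
          (hs.map' U.subtype (Submodule.ker_subtype _))
      have hcard := hg.fintype_card_le_finrank
      rw [Fintype.card_fin] at hcard
      exact (hinter U hU W hW hne).not_ge hcard
    obtain rfl : s = r := funext fun i => Subtype.ext (hval i)
    rfl
  have hle := Nat.card_le_card_of_injective f hf
  rw [card_linearIndependent hkn, Nat.card_sigma] at hle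
  have hsum : ∀ U : C, Nat.card {s : Fin t → U.1 // LinearIndependent K s} =
      ∏ i : Fin t, (Fintype.card K ^ k - Fintype.card K ^ (i : ℕ)) := fun U => by
    rw [card_linearIndependent (by rw [hdim U U.2]; exact htk), hdim U U.2]
  rwa [Finset.sum_congr rfl fun U _ => hsum U, Finset.sum_const, Finset.card_univ, smul_eq_mul,
    ← Nat.card_eq_fintype_card, Nat.card_coe_set_eq] at hle

/-- Packing bound: every set of 3-dimensional subspaces of (F_2)^13 with pairwise
intersections of dimension at most 1 has at most 1597245 elements. -/
theorem packing_bound_A2_13_4_3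
    (C : Set (Submodule (ZMod 2) (Fin 13 → ZMod 2)))
    (hdim : ∀ U ∈ C, finrank (ZMod 2) U = 3)
    (hinter : ∀ U ∈ C, ∀ V ∈ C, U ≠ V → finrank (ZMod 2) ↥(U ⊓ V) ≤ 1) :
    C.ncard ≤ 1597245 := by
  have h := ncard_mul_prod_le_of_finrank_inf_lt (t := 2) C (by norm_num) (by simp) hdim
    fun U hU V hV hne => Nat.lt_succ_of_le (hinter U hU V hV hne)
  simp only [finrank_fin_fun, ZMod.card, Fin.prod_univ_two, Fin.val_zero, Fin.val_one] at h
  norm_num at h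
  omega
end

section
/- There exists a set C of 3-dimensional subspaces of (F_2)^13 with cardinality 1597245 such that any two distinct elements U, V of C satisfy dim(U ∩ V) ≤ 1 (equivalently, subspace distance at least 4); hence A_2(13,4,3) ≥ 1597245. -/
open Module

namespace SteinerSystem

/-- Exponents (to the base of a root `α` of `X ^ 13 + X ^ 12 + X ^ 10 + X ^ 9 + 1`) of the nonzero
points of the base blocks. In each row the lines of the block are `{i, i + 1, i + 3}`. -/
def expo : Fin 15 → Fin 7 → ℕ :=
  ![![0, 1, 1249, 7258, 5040, 7978, 8105],
    ![0, 7, 1857, 6681, 7381, 7908, 7259],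
    ![0, 9, 1144, 7714, 8102, 6771, 1945],
    ![0, 11, 209, 1941, 6579, 2926, 3565],
    ![0, 12, 2181, 3696, 6965, 2519, 6673],
    ![0, 13, 4821, 8110, 5178, 7823, 8052],
    ![0, 17, 291, 5132, 8057, 6266, 1199],
    ![0, 20, 1075, 3996, 4776, 3939, 7313],
    ![0, 21, 2900, 6087, 4226, 8008, 4915],
    ![0, 27, 1190, 3572, 4989, 5199, 6710],
    ![0, 30, 141, 682, 6406, 2024, 6256],
    ![0, 31, 814, 1243, 1161, 6254, 4434],
    ![0, 37, 258, 5396, 2093, 4703, 6469],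
    ![0, 115, 949, 1272, 4873, 1580, 4539],
    ![0, 119, 490, 6670, 7312, 5941, 6812]]

/-! ### Distinctness of the exponent differences -/

/-- A complete invariant of the coset of `expo k t - expo k s` modulo the powers of two
in `ZMod 8191`. -/
def diffKey (q : Fin 15 × Fin 7 × Fin 7) : ℕ :=
  (expo q.1 q.2.2 + 8191 - expo q.1 q.2.1) ^ 13 % 8191

/-- The triples `(k, s, t)` with `s ≠ t`. -/
def triples : List (Fin 15 × Fin 7 × Fin 7) :=
  (List.finRange 15).flatMap fun k => (List.finRange 7).flatMap fun s =>
    ((List.finRange 7).filter (s ≠ ·)).map fun t => (k, s, t)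

/-- Whether `l` is free of duplicates and disjoint from the set of bits of `m`. -/
def nodupBits : List ℕ → ℕ → Bool
  | [], _ => true
  | a :: l, m => !m.testBit a && nodupBits l (m ||| 2 ^ a)

theorem nodupBits_true : nodupBits (0 :: triples.map diffKey) 0 = true := by
  decide +kernel

theorem nodup_of_nodupBits {l : List ℕ} {m : ℕ} (h : nodupBits l m = true) :
    l.Nodup ∧ ∀ a ∈ l, m.testBit a = false := by
  induction l generalizing m with
  | nil => simp
  | cons a l ih =>
    simp only [nodupBits, Bool.and_eq_true, Bool.not_eq_true'] at h
    obtain ⟨hl, hm⟩ := ih h.2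
    simp only [Nat.testBit_or, Bool.or_eq_false_iff] at hm
    refine ⟨List.nodup_cons.2 ⟨fun ha => ?_, hl⟩, ?_⟩
    · simpa [Nat.testBit_two_pow_self] using (hm a ha).2
    · simp only [List.mem_cons, forall_eq_or_imp]
      exact ⟨h.1, fun b hb => (hm b hb).1⟩

theorem nodup_diffKey : (0 :: triples.map diffKey).Nodup :=
  (nodup_of_nodupBits nodupBits_true).1

theorem mem_triples {k : Fin 15} {s t : Fin 7} (h : s ≠ t) : (k, s, t) ∈ triples := by
  simp [triples, h]

theorem diffKey_ne_zero {k : Fin 15} {s t : Fin 7} (h : s ≠ t) : diffKey (k, s, t) ≠ 0 := by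
  intro h0
  exact (List.nodup_cons.1 nodup_diffKey).1 (h0 ▸ List.mem_map_of_mem (mem_triples h))

theorem diffKey_inj {k k' : Fin 15} {s t s' t' : Fin 7} (h : s ≠ t) (h' : s' ≠ t')
    (he : diffKey (k, s, t) = diffKey (k', s', t')) : k = k' ∧ s = s' ∧ t = t' := by
  simpa using List.inj_on_of_nodup_map (List.nodup_cons.1 nodup_diffKey).2
    (mem_triples h) (mem_triples h') he

theorem expo_lt : ∀ k s, expo k s < 8191 := by
  decide +kernel

theorem cast_diffKey (k : Fin 15) (s t : Fin 7) :
    (diffKey (k, s, t) : ZMod 8191) = ((expo k t : ZMod 8191) - expo k s) ^ 13 := by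
  have h0 : (8191 : ZMod 8191) = 0 := by decide +kernel
  have h := expo_lt k s
  rw [diffKey, ZMod.natCast_mod, Nat.cast_pow, Nat.cast_sub (by dsimp only; omega)]
  push_cast
  rw [h0, add_zero]

theorem diffKey_lt (q) : diffKey q < 8191 := Nat.mod_lt _ (by norm_num)

theorem diffKey_eq_of_cast_eq {p q : Fin 15 × Fin 7 × Fin 7}
    (h : (diffKey p : ZMod 8191) = diffKey q) : diffKey p = diffKey q :=
  Nat.ModEq.eq_of_lt_of_lt ((ZMod.natCast_eq_natCast_iff _ _ _).1 h) (diffKey_lt p) (diffKey_lt q)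

theorem two_pow_injective : Function.Injective fun i : Fin 13 => (2 : ZMod 8191) ^ (i : ℕ) := by
  decide +kernel

theorem prime_8191 : Nat.Prime 8191 := by norm_num

/-- The differences of the exponents in the base blocks and all their multiples by powers of two
are distinct modulo `8191`. -/
theorem eq_of_expo_sub_mul_eq {k k' : Fin 15} {s t s' t' : Fin 7} {i i' : Fin 13}
    (h : s ≠ t) (h' : s' ≠ t')
    (he : ((expo k t : ZMod 8191) - expo k s) * 2 ^ (i : ℕ) =
      ((expo k' t' : ZMod 8191) - expo k' s') * 2 ^ (i' : ℕ)) :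
    k = k' ∧ s = s' ∧ t = t' ∧ i = i' := by
  have h2 : (2 : ZMod 8191) ^ 13 = 1 := by decide +kernel
  have := Fact.mk prime_8191
  have hpow (j : ℕ) : ((2 : ZMod 8191) ^ j) ^ 13 = 1 := by
    rw [← pow_mul, mul_comm, pow_mul, h2, one_pow]
  have hkey : diffKey (k, s, t) = diffKey (k', s', t') := by
    refine diffKey_eq_of_cast_eq ?_
    have := congrArg (· ^ 13) he
    simpa only [cast_diffKey, mul_pow _ (2 ^ _ : ZMod 8191), hpow, mul_one] using this
  obtain ⟨rfl, rfl, rfl⟩ := diffKey_inj h h' hkey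
  refine ⟨rfl, rfl, rfl, two_pow_injective (mul_left_cancel₀ (fun h0 => ?_) he)⟩
  refine diffKey_ne_zero h (k := k) (diffKey_eq_of_cast_eq (q := (0, 0, 0)) ?_)
  simp [cast_diffKey, h0]

/-! ### Arithmetic of bit vectors representing polynomials in `α` -/

/-- Application of `f` to `n`; reducing it in the kernel evaluates `n` to a numeral first. -/
def strictApp (f : ℕ → ℕ) : ℕ → ℕ
  | 0 => f 0
  | n + 1 => f (n + 1)

/-- Multiplication by `α`. -/
def mulRoot (n : ℕ) : ℕ := 2 * n ^^^ if n.testBit 12 then 13825 else 0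

/-- The product of `a` and the polynomial given by the lowest `k` bits of `b`. -/
def mulBits : ℕ → ℕ → ℕ → ℕ
  | 0, _, _ => 0
  | k + 1, a, b => 
    (if b.testBit 0 then a else 0) ^^^
      strictApp (fun a' => strictApp (mulBits k a') (b / 2)) (mulRoot a)

/-- Powers of `α`, with exponent below `2 ^ k`. -/
def powBits : ℕ → ℕ → ℕ
  | 0, _ => 1
  | k + 1, e =>
    strictApp (fun s => if e.testBit 0 then mulRoot s else s)
      (strictApp (fun r => mulBits 13 r r) (powBits k (e / 2)))

theorem powBits_expo : ∀ k i,
    powBits 13 (expo k i) ^^^ powBits 13 (expo k (i + 1)) = powBits 13 (expo k (i + 3)) := by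
  decide +kernel

theorem powBits_card : powBits 14 (2 ^ 13) = 2 := by
  decide +kernel

section Eval

variable {R : Type*} [CommRing R] {x : R}

/-- The value at `x` of the polynomial given by the lowest `k` bits of `n`. -/
def evalBits (x : R) (k n : ℕ) : R := ∑ i ∈ Finset.range k, if n.testBit i then x ^ i else 0

theorem evalBits_xor [CharP R 2] (k m n : ℕ) :
    evalBits x k (m ^^^ n) = evalBits x k m + evalBits x k n := by
  rw [evalBits, evalBits, evalBits, ← Finset.sum_add_distrib]
  refine Finset.sum_congr rfl fun i _ => ?_
  rw [Nat.testBit_xor]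
  cases m.testBit i <;> cases n.testBit i <;> simp [CharTwo.add_self_eq_zero]

theorem evalBits_zero_right (k : ℕ) : evalBits x k 0 = 0 := by simp [evalBits]

theorem evalBits_succ (k n : ℕ) :
    evalBits x (k + 1) n = (if n.testBit 0 then 1 else 0) + x * evalBits x k (n / 2) := by
  rw [evalBits, Finset.sum_range_succ', add_comm, evalBits, Finset.mul_sum]
  congr 1
  · simp
  · refine Finset.sum_congr rfl fun i _ => ?_
    rw [Nat.testBit_succ, mul_ite, mul_zero, pow_succ']

theorem strictApp_eq (f : ℕ → ℕ) (n : ℕ) : strictApp f n = f n := by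
  cases n <;> rfl

theorem evalBits_one : evalBits x 13 1 = 1 := by
  simp [evalBits_succ, evalBits_zero_right]

theorem evalBits_two : evalBits x 13 2 = x := by
  simp [evalBits_succ, evalBits_zero_right]

variable [CharP R 2] (hx : x ^ 13 + x ^ 12 + x ^ 10 + x ^ 9 + 1 = 0)
include hx

theorem evalBits_mulRoot (n : ℕ) : evalBits x 13 (mulRoot n) = x * evalBits x 13 n := by
  have hred : evalBits x 13 13825 = x ^ 13 := by
    have h : evalBits x 13 13825 = x ^ 12 + x ^ 10 + x ^ 9 + 1 := by
      simp [evalBits, Finset.sum_range_succ, Nat.testBit]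
      ring
    rw [h, ← CharTwo.add_eq_zero, ← hx]
    ring
  have hdouble : evalBits x 13 (2 * n) = x * evalBits x 12 n := by
    simp [evalBits_succ]
  have hlast : evalBits x 13 n = evalBits x 12 n + if n.testBit 12 then x ^ 12 else 0 :=
    Finset.sum_range_succ _ 12
  rw [mulRoot, evalBits_xor, hdouble, hlast, mul_add]
  split_ifs
  · rw [hred, pow_succ']
  · simp [evalBits_zero_right]

theorem evalBits_mulBits (k a b : ℕ) :
    evalBits x 13 (mulBits k a b) = evalBits x 13 a * evalBits x k b := by
  induction k generalizing a b with
  | zero => simp [mulBits, evalBits]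
  | succ k ih =>
    rw [mulBits, strictApp_eq, strictApp_eq, evalBits_xor, ih, evalBits_mulRoot hx,
      evalBits_succ k b]
    split_ifs
    · ring
    · rw [evalBits_zero_right]
      ring

theorem evalBits_powBits {k e : ℕ} (he : e < 2 ^ k) : evalBits x 13 (powBits k e) = x ^ e := by
  induction k generalizing e with
  | zero =>
    obtain rfl : e = 0 := by simpa using he
    simp [powBits, evalBits_one]
  | succ k ih =>
    have hsq : evalBits x 13 (mulBits 13 (powBits k (e / 2)) (powBits k (e / 2))) =
        x ^ (e / 2 * 2) := by
      rw [evalBits_mulBits hx, ih (by omega), pow_mul, sq]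
    rw [powBits, strictApp_eq, strictApp_eq]
    rcases Nat.mod_two_eq_zero_or_one e with h | h
    · rw [if_neg (by simp [h]), hsq]
      congr 1
      omega
    · rw [if_pos (by simp [h]), evalBits_mulRoot hx, hsq, ← pow_succ']
      congr 1
      omega

theorem pow_expo_add (k : Fin 15) (s : Fin 7) :
    x ^ expo k s + x ^ expo k (s + 1) = x ^ expo k (s + 3) := by
  have hlt (s) : expo k s < 2 ^ 13 := (expo_lt k s).trans (by norm_num)
  rw [← evalBits_powBits hx (hlt _), ← evalBits_powBits hx (hlt _), ← evalBits_powBits hx (hlt _),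
    ← evalBits_xor, powBits_expo]

theorem pow_card_of_isRoot : x ^ 2 ^ 13 = x := by
  rw [← evalBits_powBits hx (k := 14) (by norm_num), powBits_card, evalBits_two]

end Eval

open Polynomial in
theorem exists_root : ∃ x : GaloisField 2 13, x ^ 13 + x ^ 12 + x ^ 10 + x ^ 9 + 1 = 0 := by
  let p : (ZMod 2)[X] := X ^ 13 + X ^ 12 + X ^ 10 + X ^ 9 + 1
  have hdeg : p.degree = 13 := by
    unfold p
    compute_degree!
  have hdvd : p ∣ X ^ 2 ^ 13 - X := by
    have : Nontrivial (AdjoinRoot p) := AdjoinRoot.nontrivial p (by simp [hdeg])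
    have : CharP (AdjoinRoot p) 2 := charP_of_injective_algebraMap (AdjoinRoot.of p).injective 2
    have hroot : AdjoinRoot.root p ^ 13 + AdjoinRoot.root p ^ 12 + AdjoinRoot.root p ^ 10 +
        AdjoinRoot.root p ^ 9 + 1 = 0 := by
      simpa only [p, map_add, map_pow, map_one, AdjoinRoot.mk_X] using AdjoinRoot.mk_self (f := p)
    rw [← AdjoinRoot.mk_eq_zero]
    rw [map_sub, map_pow, AdjoinRoot.mk_X, pow_card_of_isRoot hroot, sub_self]
  have hne : (X ^ 2 ^ 13 - X : (ZMod 2)[X]) ≠ 0 :=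
    FiniteField.X_pow_card_pow_sub_X_ne_zero _ (by norm_num) one_lt_two
  have hsplits : (p.map (algebraMap (ZMod 2) (GaloisField 2 13))).Splits := by
    have h := SplittingField.splits (X ^ 2 ^ 13 - X : (ZMod 2)[X])
    exact h.of_dvd (Polynomial.map_ne_zero hne) (Polynomial.map_dvd _ hdvd)
  obtain ⟨x, hx⟩ := hsplits.exists_eval_eq_zero (by simp [degree_map, hdeg])
  exact ⟨x, by simpa [p] using hx⟩

/-! ### The blocks -/

section Blocks

variable {K : Type*} [Field K] {x : K}

/-- The nonzero points of the block obtained from the `k`-th base block by applying the `i`-th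
power of the Frobenius and multiplying by `a`. -/
def point (x : K) (q : Kˣ × Fin 13 × Fin 15) (s : Fin 7) : K :=
  q.1 * (x ^ expo q.2.2 s) ^ 2 ^ (q.2.1 : ℕ)

theorem ne_zero_of_isRoot (hx : x ^ 13 + x ^ 12 + x ^ 10 + x ^ 9 + 1 = 0) : x ≠ 0 := by
  rintro rfl
  simp at hx

theorem point_ne_zero (hx0 : x ≠ 0) (q : Kˣ × Fin 13 × Fin 15) (s : Fin 7) : point x q s ≠ 0 := by
  simp [point, hx0]

theorem exists_point_add [CharP K 2] (hx : x ^ 13 + x ^ 12 + x ^ 10 + x ^ 9 + 1 = 0)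
    (q : Kˣ × Fin 13 × Fin 15) {s t : Fin 7} (hst : s ≠ t) :
    ∃ r, point x q s + point x q t = point x q r := by
  have hline (s) : point x q s + point x q (s + 1) = point x q (s + 3) := by
    rw [point, point, point, ← pow_expo_add hx, add_pow_char_pow, mul_add]
  have hline₁ (s) : point x q s + point x q (s + 3) = point x q (s + 1) := by
    rw [← hline, ← add_assoc, CharTwo.add_self_eq_zero, zero_add]
  have hline₂ (s) : point x q (s + 1) + point x q (s + 3) = point x q s := by
    rw [← hline₁, add_assoc, CharTwo.add_self_eq_zero, add_zero]
  have hst' : t = s + 1 ∨ s = t + 1 ∨ t = s + 3 ∨ s = t + 3 ∨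
      (∃ r, s = r + 1 ∧ t = r + 3) ∨ ∃ r, t = r + 1 ∧ s = r + 3 := by
    revert s t
    decide
  rcases hst' with rfl | rfl | rfl | rfl | ⟨r, rfl, rfl⟩ | ⟨r, rfl, rfl⟩
  · exact ⟨_, hline _⟩
  · exact ⟨_, (add_comm _ _).trans (hline _)⟩
  · exact ⟨_, hline₁ _⟩
  · exact ⟨_, (add_comm _ _).trans (hline₁ _)⟩
  · exact ⟨_, hline₂ _⟩
  · exact ⟨_, (add_comm _ _).trans (hline₂ _)⟩

/-- Two distinct points determine the block containing them. -/
theorem eq_of_point_eq (hx0 : x ≠ 0) (hord : orderOf x = 8191) {q q' : Kˣ × Fin 13 × Fin 15}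
    {s t s' t' : Fin 7} (hst : s ≠ t) (hst' : s' ≠ t') (hs : point x q s = point x q' s')
    (ht : point x q t = point x q' t') : q = q' := by
  obtain ⟨a, i, k⟩ := q
  obtain ⟨b, i', k'⟩ := q'
  simp only [point, ← pow_mul] at hs ht
  have hpow : x ^ (expo k t * 2 ^ (i : ℕ) + expo k' s' * 2 ^ (i' : ℕ)) =
      x ^ (expo k' t' * 2 ^ (i' : ℕ) + expo k s * 2 ^ (i : ℕ)) := by
    have hab : (a * b : K) ≠ 0 := by simp
    refine mul_left_cancel₀ hab ?_
    rw [pow_add, pow_add, mul_mul_mul_comm, ht, ← hs]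
    ring
  obtain ⟨u, rfl⟩ := hx0.isUnit
  rw [orderOf_units] at hord
  rw [← Units.val_pow_eq_pow_val, ← Units.val_pow_eq_pow_val, Units.val_inj,
    pow_eq_pow_iff_modEq, hord, ← ZMod.natCast_eq_natCast_iff] at hpow
  push_cast at hpow
  obtain ⟨rfl, rfl, rfl, rfl⟩ := eq_of_expo_sub_mul_eq (i := i) (i' := i') hst hst'
    (by linear_combination hpow)
  rw [Prod.mk.injEq, Units.ext_iff]
  exact ⟨mul_right_cancel₀ (pow_ne_zero _ u.ne_zero) hs, rfl⟩

theorem point_injective (hx0 : x ≠ 0) (hord : orderOf x = 8191) (q : Kˣ × Fin 13 × Fin 15) :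
    Function.Injective (point x q) := by
  intro s t h
  by_contra hst
  obtain ⟨a, i, k⟩ := q
  obtain ⟨u, rfl⟩ := hx0.isUnit
  rw [orderOf_units] at hord
  simp only [point, ← pow_mul] at h
  have hpow := mul_left_cancel₀ a.ne_zero h
  rw [← Units.val_pow_eq_pow_val, ← Units.val_pow_eq_pow_val, Units.val_inj,
    pow_eq_pow_iff_modEq, hord, ← ZMod.natCast_eq_natCast_iff] at hpow
  push_cast at hpow
  exact hst (eq_of_expo_sub_mul_eq (i := i) (i' := i) hst (Ne.symm hst)
    (by linear_combination -2 * hpow)).2.1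

variable [CharP K 2]

/-- The block with nonzero points `point x q s`. -/
def block (hx : x ^ 13 + x ^ 12 + x ^ 10 + x ^ 9 + 1 = 0) (q : Kˣ × Fin 13 × Fin 15) :
    AddSubgroup K where
  carrier := insert 0 (Set.range (point x q))
  zero_mem' := Set.mem_insert _ _
  neg_mem' := by
    intro y hy
    rwa [CharTwo.neg_eq]
  add_mem' := by
    rintro _ _ (rfl | ⟨s, rfl⟩) (rfl | ⟨t, rfl⟩)
    · simp
    · simp
    · simp
    · by_cases hst : s = t
      · simp [hst, CharTwo.add_self_eq_zero]
      · obtain ⟨r, hr⟩ := exists_point_add hx q hst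
        exact Or.inr ⟨r, hr.symm⟩

variable [Algebra (ZMod 2) K] (hx : x ^ 13 + x ^ 12 + x ^ 10 + x ^ 9 + 1 = 0)
  (hord : orderOf x = 8191)
include hord

theorem finrank_block [Finite K] (q : Kˣ × Fin 13 × Fin 15) :
    finrank (ZMod 2) (AddSubgroup.toZModSubmodule 2 (block hx q)) = 3 := by
  have hx0 := ne_zero_of_isRoot hx
  have hcard : Nat.card (AddSubgroup.toZModSubmodule 2 (block hx q)) = 2 ^ 3 := by
    change Nat.card (insert 0 (Set.range (point x q)) : Set K) = 2 ^ 3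
    rw [Nat.card_coe_set_eq, Set.ncard_insert_of_notMem,
      Set.ncard_range_of_injective (point_injective hx0 hord q), Nat.card_fin]
    · norm_num
    · rintro ⟨s, hs⟩
      exact point_ne_zero hx0 q s hs
  rw [Module.natCard_eq_pow_finrank (K := ZMod 2), Nat.card_zmod] at hcard
  exact Nat.pow_right_injective le_rfl hcard

theorem finrank_block_inf_le [Finite K] {q q' : Kˣ × Fin 13 × Fin 15} (hq : q ≠ q') :
    finrank (ZMod 2) ↥(AddSubgroup.toZModSubmodule 2 (block hx q) ⊓
      AddSubgroup.toZModSubmodule 2 (block hx q')) ≤ 1 := by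
  have hx0 := ne_zero_of_isRoot hx
  have heq : ∀ y ∈ block hx q ⊓ block hx q', ∀ z ∈ block hx q ⊓ block hx q',
      y ≠ 0 → z ≠ 0 → y = z := by
    rintro y ⟨hy, hy'⟩ z ⟨hz, hz'⟩ hy0 hz0
    by_contra hyz
    obtain ⟨s, hs⟩ := hy.resolve_left hy0
    obtain ⟨s', hs'⟩ := hy'.resolve_left hy0
    obtain ⟨t, ht⟩ := hz.resolve_left hz0
    obtain ⟨t', ht'⟩ := hz'.resolve_left hz0
    refine hq (eq_of_point_eq hx0 hord (s := s) (t := t) (s' := s') (t' := t') ?_ ?_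
      (hs.trans hs'.symm) (ht.trans ht'.symm))
    · rintro rfl
      exact hyz (hs.symm.trans ht)
    · rintro rfl
      exact hyz (hs'.symm.trans ht')
  by_cases hbot : ∃ y ∈ block hx q ⊓ block hx q', y ≠ 0
  · obtain ⟨y, hy, hy0⟩ := hbot
    refine finrank_le_one ⟨y, hy⟩ fun ⟨z, hz⟩ => ?_
    by_cases hz0 : z = 0
    · exact ⟨0, Subtype.ext (by simp [hz0])⟩
    · exact ⟨1, Subtype.ext (by simp [heq y hy z hz hy0 hz0])⟩
  · push Not at hbot
    exact finrank_le_one 0 fun ⟨z, hz⟩ => ⟨0, Subtype.ext (by simp [hbot z hz])⟩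

end Blocks

theorem orderOf_root {x : GaloisField 2 13} (hx : x ^ 13 + x ^ 12 + x ^ 10 + x ^ 9 + 1 = 0) :
    orderOf x = 8191 := by
  have := Fact.mk prime_8191
  refine orderOf_eq_prime ?_ ?_
  · refine mul_left_cancel₀ (ne_zero_of_isRoot hx) ?_
    rw [← pow_succ', mul_one]
    exact pow_card_of_isRoot hx
  · rintro rfl
    have h2 : (2 : GaloisField 2 13) = 0 := CharTwo.two_eq_zero
    exact one_ne_zero (α := GaloisField 2 13) (by linear_combination hx - 2 * h2)

end SteinerSystem

open SteinerSystem

/-- There is a set of 1597245 three-dimensional subspaces of (F_2)^13 whose pairwise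
intersections have dimension at most 1; hence A_2(13,4,3) ≥ 1597245. -/
theorem A2_13_4_3_lower_bound :
    ∃ C : Set (Submodule (ZMod 2) (Fin 13 → ZMod 2)),
      C.ncard = 1597245 ∧
      (∀ U ∈ C, finrank (ZMod 2) U = 3) ∧
      (∀ U ∈ C, ∀ V ∈ C, U ≠ V → finrank (ZMod 2) ↥(U ⊓ V) ≤ 1) := by
  obtain ⟨x, hx⟩ := exists_root
  have hord := orderOf_root hx
  let e : GaloisField 2 13 ≃ₗ[ZMod 2] (Fin 13 → ZMod 2) :=
    LinearEquiv.ofFinrankEq _ _ (by rw [GaloisField.finrank 2 (by norm_num), finrank_fin_fun])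
  let U (q : (GaloisField 2 13)ˣ × Fin 13 × Fin 15) : Submodule (ZMod 2) (Fin 13 → ZMod 2) :=
    (AddSubgroup.toZModSubmodule 2 (block hx q)).map (e : _ →ₗ[ZMod 2] _)
  have hU (q) : finrank (ZMod 2) (U q) = 3 := by
    rw [LinearEquiv.finrank_map_eq, finrank_block hx hord]
  have hinf {q q'} (hq : q ≠ q') : finrank (ZMod 2) ↥(U q ⊓ U q') ≤ 1 := by
    rw [← Submodule.map_inf _ e.injective, LinearEquiv.finrank_map_eq]
    exact finrank_block_inf_le hx hord hq
  have hinj : Function.Injective U := by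
    intro q q' h
    by_contra hq
    have := hinf hq
    rw [← h, inf_idem, hU] at this
    omega
  refine ⟨Set.range U, ?_, ?_, ?_⟩
  · rw [Set.ncard_range_of_injective hinj, Nat.card_prod, Nat.card_prod, Nat.card_units,
      GaloisField.card 2 13 (by norm_num), Nat.card_fin, Nat.card_fin]
    norm_num
  · rintro _ ⟨q, rfl⟩
    exact hU q
  · rintro _ ⟨q, rfl⟩ _ ⟨q', rfl⟩ h
    exact hinf fun hq => h (congrArg U hq)
end
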